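/- Let A (of size n), L (of size r), D (of size k − 1 − r) and Ω (of size t + 1 − n) be pairwise disjoint ordered subsequences of S. If n ≤ r ≤ n + p − 1 and r ≤ t + 2, then ∑_{B ⊆ L, |B| = n} (−1)^{σ(B,L)} P_{D ∪ (L \ B)}(A, B) ∏_{z ∈ Ω ∪ B} det(z, A, L \ B, D)^{−1} = (−1)^{(r−n)(nt+n+1)} ∑_{Δ ⊆ Ω, |Δ| = r − n} P_D(A ⌢ Δ, L) ∏_{z ∈ (Ω \ Δ) ∪ L} det(z, A, Δ, D)^{−1}, where A ⌢ Δ is the concatenation of A and Δ. -/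

import Mathlib

/-- `detCols L` is the determinant of the `k × k` matrix whose `j`-th column is the
`j`-th entry of the list `L` (lists of length ≠ `k` are padded with `0`). -/
def detCols {F : Type} [CommRing F] {k : ℕ} (L : List (Fin k → F)) : F :=
  Matrix.det (Matrix.of fun i j : Fin k => L.getD (j : ℕ) 0 i)

/-- The Segre product `P_D(A, B)` of the sequences `A = (a_1, …, a_n)` and
`B = (b_0, …, b_{n−1})` with base `D`, with respect to the family of tangent functions `T`:
`∏_{i=1}^n T_{D ∪ {a_1,…,a_{i−1},b_i,…,b_{n−1}}}(a_i) ·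
  T_{D ∪ {a_1,…,a_{i−1},b_i,…,b_{n−1}}}(b_{i−1})⁻¹`. -/
def segreP {F : Type} [Field F] [DecidableEq F] {k : ℕ}
    (T : Finset (Fin k → F) → (Fin k → F) → F)
    (D : Finset (Fin k → F)) (A B : List (Fin k → F)) : F :=
  ∏ j ∈ Finset.range A.length,
    (T (D ∪ (A.take j).toFinset ∪ (B.drop (j + 1)).toFinset) (A.getD j 0) *
      (T (D ∪ (A.take j).toFinset ∪ (B.drop (j + 1)).toFinset) (B.getD j 0))⁻¹)

/-- `T` is a family of tangent functions for `S` (with `t` tangent hyperplanes through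
each subset of size `k − 2`): for every `Y ⊆ S` with `|Y| = k − 2` there is a set `Φ` of
`t` pairwise linearly independent linear forms, each vanishing on `Y` and nonzero at every
vector of `S \ Y`, with `T Y = ∏_{α ∈ Φ} α`. -/
def IsTangentFamily {F : Type} [Field F] [DecidableEq F] {k : ℕ} (t : ℕ)
    (S : Finset (Fin k → F)) (T : Finset (Fin k → F) → (Fin k → F) → F) : Prop :=
  ∀ Y : Finset (Fin k → F), Y ⊆ S → Y.card = k - 2 →
    ∃ Φ : Finset ((Fin k → F) →ₗ[F] F),
      Φ.card = t ∧
      (∀ α ∈ Φ, ∀ β ∈ Φ, α ≠ β → ∀ c : F, α ≠ c • β) ∧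
      (∀ α ∈ Φ, ∀ y ∈ Y, α y = 0) ∧
      (∀ α ∈ Φ, ∀ s ∈ S, s ∉ Y → α s ≠ 0) ∧
      (∀ x, T Y x = ∏ α ∈ Φ, α x)

/-- The subsequence of `L` consisting of the entries whose positions lie in `s`,
in their original order (`d` is a default value). -/
def subseq {α : Type} (d : α) (L : List α) (s : Finset ℕ) : List α :=
  ((List.range L.length).filter (fun i => decide (i ∈ s))).map (fun i => L.getD i d)

/-- The subsequence of `L` consisting of the entries whose positions do not lie in `s`,
in their original order (`d` is a default value). -/
def subseqC {α : Type} (d : α) (L : List α) (s : Finset ℕ) : List α :=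
  ((List.range L.length).filter (fun i => decide (i ∉ s))).map (fun i => L.getD i d)

/-- The number of transpositions needed (counted as the number of inversions) to reorder a
list of length `len` so that the entries in positions `s` occupy the last `|s|` positions,
preserving the relative order of the two groups. -/
def invCount (s : Finset ℕ) (len : ℕ) : ℕ :=
  ((Finset.range len ×ˢ Finset.range len).filter
    (fun ij => ij.1 ∈ s ∧ ij.2 ∉ s ∧ ij.1 < ij.2)).card

theorem apply_middle_cons {α K : Type} [CommMonoid K] {f : List α → K} {c : K}
    (hf : ∀ u a b v, f (u ++ a :: b :: v) = c * f (u ++ b :: a :: v)) (a : α) (m : List α) :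
    ∀ u v : List α, f (u ++ m ++ a :: v) = c ^ m.length * f (u ++ a :: m ++ v) := by
  induction m with
  | nil => intro u v; simp
  | cons b m ih =>
    intro u v
    have h1 := ih (u ++ [b]) v
    have h2 := hf u b a (m ++ v)
    simp only [List.append_assoc, List.cons_append, List.nil_append, List.length_cons] at h1 h2 ⊢
    rw [h1, h2, pow_succ, mul_assoc]

theorem apply_append_comm {α K : Type} [CommMonoid K] {f : List α → K} {c : K}
    (hf : ∀ u a b v, f (u ++ a :: b :: v) = c * f (u ++ b :: a :: v)) (m m' v : List α) :
    ∀ u : List α, f (u ++ m ++ m' ++ v) = c ^ (m.length * m'.length) * f (u ++ m' ++ m ++ v) := by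
  induction m' with
  | nil => intro u; simp
  | cons a m' ih =>
    intro u
    have h1 := apply_middle_cons hf a m u (m' ++ v)
    have h2 := ih (u ++ [a])
    simp only [List.append_assoc, List.cons_append, List.nil_append, List.length_cons] at h1 h2 ⊢
    rw [h1, h2, ← mul_assoc, ← pow_add, mul_add, mul_one, add_comm]

theorem exists_pow_of_perm {α : Type} {l l' : List α} (h : l.Perm l') :
    ∃ N : ℕ, ∀ (K : Type) [CommMonoid K] (f : List α → K) (c : K),
      (∀ u a b v, f (u ++ a :: b :: v) = c * f (u ++ b :: a :: v)) →
      ∀ u, f (u ++ l) = c ^ N * f (u ++ l') := by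
  induction h with
  | nil => exact ⟨0, fun K _ f c hf u => by simp⟩
  | cons a _ ih =>
    obtain ⟨N, hN⟩ := ih
    refine ⟨N, fun K _ f c hf u => ?_⟩
    simpa using hN K f c hf (u ++ [a])
  | swap a b l => exact ⟨1, fun K _ f c hf u => by simpa using hf u b a l⟩
  | trans _ _ ih ih' =>
    obtain ⟨N, hN⟩ := ih
    obtain ⟨N', hN'⟩ := ih'
    refine ⟨N + N', fun K _ f c hf u => ?_⟩
    rw [hN K f c hf, hN' K f c hf, pow_add, mul_assoc]

theorem subseq_append_singleton {α : Type} (d : α) (L : List α) (x : α) (s : Finset ℕ) :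
    subseq d (L ++ [x]) s = subseq d L s ++ if L.length ∈ s then [x] else [] := by
  unfold subseq
  rw [List.length_append, List.length_singleton, List.range_succ, List.filter_append,
    List.map_append]
  congr 1
  · refine List.map_congr_left fun i hi => ?_
    have : i < L.length := by simpa using (List.mem_filter.1 hi).1
    simp [List.getD_eq_getElem?_getD, List.getElem?_append_left this]
  · by_cases h : L.length ∈ s <;> simp [h]

theorem subseqC_append_singleton {α : Type} (d : α) (L : List α) (x : α) (s : Finset ℕ) :
    subseqC d (L ++ [x]) s = subseqC d L s ++ if L.length ∈ s then [] else [x] := by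
  unfold subseqC
  rw [List.length_append, List.length_singleton, List.range_succ, List.filter_append,
    List.map_append]
  congr 1
  · refine List.map_congr_left fun i hi => ?_
    have : i < L.length := by simpa using (List.mem_filter.1 hi).1
    simp [List.getD_eq_getElem?_getD, List.getElem?_append_left this]
  · by_cases h : L.length ∈ s <;> simp [h]

theorem invCount_succ (s : Finset ℕ) (m : ℕ) :
    invCount s (m + 1) =
      invCount s m + if m ∈ s then 0 else ((Finset.range m).filter (· ∈ s)).card := by
  unfold invCount
  have hsplit : (Finset.range (m + 1) ×ˢ Finset.range (m + 1)).filter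
      (fun ij => ij.1 ∈ s ∧ ij.2 ∉ s ∧ ij.1 < ij.2) =
      ((Finset.range m ×ˢ Finset.range m).filter
        (fun ij => ij.1 ∈ s ∧ ij.2 ∉ s ∧ ij.1 < ij.2)) ∪
      (if m ∈ s then ∅ else ((Finset.range m).filter (· ∈ s)).image fun i => (i, m)) := by
    ext ⟨i, j⟩
    split_ifs with h <;>
    simp only [Finset.mem_filter, Finset.mem_product, Finset.mem_range, Finset.mem_union,
      Finset.mem_image, Prod.mk.injEq, Finset.notMem_empty, or_false]
    · constructor
      · rintro ⟨⟨hi, hj⟩, his, hjs, hij⟩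
        have : j ≠ m := by rintro rfl; exact hjs h
        exact ⟨⟨by omega, by omega⟩, his, hjs, hij⟩
      · rintro ⟨⟨hi, hj⟩, his, hjs, hij⟩
        exact ⟨⟨by omega, by omega⟩, his, hjs, hij⟩
    · constructor
      · rintro ⟨⟨hi, hj⟩, his, hjs, hij⟩
        by_cases hjm : j = m
        · exact Or.inr ⟨i, ⟨by omega, his⟩, rfl, hjm.symm⟩
        · exact Or.inl ⟨⟨by omega, by omega⟩, his, hjs, hij⟩
      · rintro (⟨⟨hi, hj⟩, his, hjs, hij⟩ | ⟨i', ⟨hi, his⟩, rfl, rfl⟩)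
        · exact ⟨⟨by omega, by omega⟩, his, hjs, hij⟩
        · exact ⟨⟨by omega, by omega⟩, his, h, hi⟩
  rw [hsplit, Finset.card_union_of_disjoint]
  · split_ifs with h
    · simp
    · rw [Finset.card_image_of_injective _ fun i j hij => (Prod.mk.inj hij).1]
  · split_ifs with h
    · simp
    · rw [Finset.disjoint_left]
      rintro ⟨i, j⟩ h1 h2
      simp only [Finset.mem_filter, Finset.mem_product, Finset.mem_range, Finset.mem_image,
        Prod.mk.injEq] at h1 h2
      obtain ⟨i', -, -, rfl⟩ := h2
      exact lt_irrefl _ h1.1.2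

theorem length_subseq {α : Type} (d : α) (L : List α) (s : Finset ℕ) :
    (subseq d L s).length = ((Finset.range L.length).filter (· ∈ s)).card := by
  unfold subseq
  rw [List.length_map, ← List.toFinset_card_of_nodup (List.nodup_range.filter _)]
  congr 1
  ext i
  simp

theorem apply_subseqC_append_subseq {α K : Type} [CommMonoid K] {f : List α → K} {c : K}
    (hf : ∀ u a b v, f (u ++ a :: b :: v) = c * f (u ++ b :: a :: v)) (d : α) (s : Finset ℕ) (L : List α) :
    ∀ v : List α,
      f (L ++ v) = c ^ invCount s L.length * f (subseqC d L s ++ subseq d L s ++ v) := by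
  induction L using List.reverseRecOn with
  | nil => intro v; simp [subseq, subseqC, invCount]
  | append_singleton L x ih =>
    intro v
    have h1 := ih (x :: v)
    rw [List.length_append, List.length_singleton, invCount_succ, subseq_append_singleton,
      subseqC_append_singleton, List.append_assoc, List.singleton_append, h1]
    split_ifs with h
    · simp
    · have h2 := apply_middle_cons hf x (subseq d L s) (subseqC d L s) v
      rw [length_subseq] at h2
      rw [h2]
      simp only [List.append_assoc, List.append_nil, List.cons_append, List.nil_append, pow_add, mul_assoc]

theorem subseqC_append_subseq_perm {α : Type} (d : α) (L : List α) (s : Finset ℕ) :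
    (subseqC d L s ++ subseq d L s).Perm L := by
  induction L using List.reverseRecOn with
  | nil => simp [subseq, subseqC]
  | append_singleton L x ih =>
    rw [subseq_append_singleton, subseqC_append_singleton]
    split_ifs with h
    · rw [List.append_nil, ← List.append_assoc]
      exact ih.append_right _
    · rw [List.append_nil, List.append_assoc]
      refine List.Perm.trans ?_ (ih.append_right [x])
      rw [List.append_assoc]
      exact List.Perm.append_left _ List.perm_append_comm

theorem sum_powersetCard_toFinset {α K : Type} [DecidableEq α] [AddCommMonoid K]
    (d : α) (L : List α) (hL : L.Nodup) (n : ℕ) (H : Finset α → K) :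
    ∑ s ∈ Finset.powersetCard n (Finset.range L.length), H (subseq d L s).toFinset =
      ∑ C ∈ Finset.powersetCard n L.toFinset, H C := by
  have hset : ∀ s ⊆ Finset.range L.length,
      (subseq d L s).toFinset = s.image fun i => L.getD i d := by
    intro s hs
    ext x
    simp only [subseq, List.mem_toFinset, List.mem_map, List.mem_filter, List.mem_range,
      decide_eq_true_eq, Finset.mem_image]
    exact ⟨fun ⟨i, h, e⟩ => ⟨i, h.2, e⟩, fun ⟨i, h, e⟩ => ⟨i, ⟨by simpa using hs h, h⟩, e⟩⟩
  have hinj : Set.InjOn (fun i => L.getD i d) (Finset.range L.length : Set ℕ) := by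
    intro i hi j hj hij
    have hi' : i < L.length := by simpa using hi
    have hj' : j < L.length := by simpa using hj
    simp only [List.getD_eq_getElem _ _ hi', List.getD_eq_getElem _ _ hj'] at hij
    exact (hL.getElem_inj_iff).1 hij
  have himg : (Finset.range L.length).image (fun i => L.getD i d) = L.toFinset := by
    ext x
    simp only [Finset.mem_image, Finset.mem_range, List.mem_toFinset, List.mem_iff_getElem]
    exact ⟨fun ⟨i, h, e⟩ => ⟨i, h, by rw [← e, List.getD_eq_getElem]⟩,
      fun ⟨i, h, e⟩ => ⟨i, h, by rw [← e, List.getD_eq_getElem]⟩⟩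
  refine Finset.sum_bij (fun s _ => s.image fun i => L.getD i d) ?_ ?_ ?_ ?_
  · intro s hs
    rw [Finset.mem_powersetCard] at hs ⊢
    refine ⟨himg ▸ Finset.image_subset_image hs.1, ?_⟩
    rw [Finset.card_image_of_injOn (hinj.mono (by exact_mod_cast hs.1)), hs.2]
  · intro s hs s' hs' h
    rw [Finset.mem_powersetCard] at hs hs'
    rw [← Finset.coe_inj] at h ⊢
    rw [Finset.coe_image, Finset.coe_image] at h
    exact (hinj.image_eq_image_iff (by exact_mod_cast hs.1) (by exact_mod_cast hs'.1)).1 h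
  · intro C hC
    rw [Finset.mem_powersetCard, ← himg] at hC
    obtain ⟨s, hs, hsC⟩ := Finset.subset_image_iff.1 hC.1
    refine ⟨s, ?_, hsC⟩
    rw [Finset.mem_powersetCard]
    refine ⟨by exact_mod_cast hs, ?_⟩
    rw [← hC.2, ← hsC, Finset.card_image_of_injOn (hinj.mono hs)]
  · intro s hs
    rw [hset s (Finset.mem_powersetCard.1 hs).1]

/-- A function on the `m`-subsets of `E` whose sums over the supersets of every `(m - 1)`-subset
vanish has, up to sign, equal sums over the `m`-subsets of `L` and of its complement. -/
theorem sum_powersetCard_eq_neg_one_pow_mul {α K : Type} [DecidableEq α] [Field K]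
    (E L : Finset α) (hLE : L ⊆ E) (m : ℕ) (hm : ∀ j < m, ((j + 1 : ℕ) : K) ≠ 0)
    (H : Finset α → K)
    (hH : ∀ Y ⊆ E, Y.card + 1 = m → ∑ x ∈ E \ Y, H (insert x Y) = 0) :
    ∑ C ∈ Finset.powersetCard m L, H C =
      (-1) ^ m * ∑ C ∈ Finset.powersetCard m (E \ L), H C := by
  let s : ℕ → K := fun j =>
    ∑ C ∈ (Finset.powersetCard m E).filter (fun C => (C ∩ L).card = j), H C
  have hs0 : s 0 = ∑ C ∈ Finset.powersetCard m (E \ L), H C := by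
    refine Finset.sum_congr ?_ fun _ _ => rfl
    ext C
    simp only [Finset.mem_filter, Finset.mem_powersetCard, Finset.card_eq_zero,
      ← Finset.disjoint_iff_inter_eq_empty, Finset.subset_sdiff]
    tauto
  have hsm : s m = ∑ C ∈ Finset.powersetCard m L, H C := by
    refine Finset.sum_congr ?_ fun _ _ => rfl
    ext C
    simp only [Finset.mem_filter, Finset.mem_powersetCard]
    constructor
    · rintro ⟨⟨-, hc⟩, hi⟩
      refine ⟨?_, hc⟩
      rw [← Finset.eq_of_subset_of_card_le Finset.inter_subset_left (hc.trans hi.symm).le]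
      exact Finset.inter_subset_right
    · rintro ⟨h, hc⟩
      exact ⟨⟨h.trans hLE, hc⟩, by rw [Finset.inter_eq_left.2 h, hc]⟩
  have hrec : ∀ j < m, ((j + 1 : ℕ) : K) * s (j + 1) + ((m - j : ℕ) : K) * s j = 0 := by
    intro j hj
    have h0 : ∑ Y ∈ (Finset.powersetCard (m - 1) E).filter (fun Y => (Y ∩ L).card = j),
        ∑ x ∈ E \ Y, H (insert x Y) = 0 := by
      refine Finset.sum_eq_zero fun Y hY => ?_
      simp only [Finset.mem_filter, Finset.mem_powersetCard] at hY
      exact hH Y hY.1.1 (by omega)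
    have h1 : ∑ Y ∈ (Finset.powersetCard (m - 1) E).filter (fun Y => (Y ∩ L).card = j),
        ∑ x ∈ E \ Y, H (insert x Y) =
        ∑ C ∈ Finset.powersetCard m E,
          ∑ x ∈ C.filter (fun x => ((C.erase x) ∩ L).card = j), H C := by
      rw [Finset.sum_sigma', Finset.sum_sigma']
      refine Finset.sum_bij' (fun a _ => ⟨insert a.2 a.1, a.2⟩)
        (fun b _ => ⟨b.1.erase b.2, b.2⟩) ?_ ?_ ?_ ?_ ?_
      · rintro ⟨Y, x⟩ h
        simp only [Finset.mem_sigma, Finset.mem_filter, Finset.mem_powersetCard,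
          Finset.mem_sdiff] at h ⊢
        obtain ⟨⟨⟨hYE, hYc⟩, hYj⟩, hxE, hxY⟩ := h
        refine ⟨⟨Finset.insert_subset hxE hYE, ?_⟩, Finset.mem_insert_self _ _, ?_⟩
        · rw [Finset.card_insert_of_notMem hxY]; omega
        · rw [Finset.erase_insert hxY, hYj]
      · rintro ⟨C, x⟩ h
        simp only [Finset.mem_sigma, Finset.mem_filter, Finset.mem_powersetCard,
          Finset.mem_sdiff] at h ⊢
        obtain ⟨⟨hCE, hCc⟩, hxC, hj⟩ := h
        refine ⟨⟨⟨(Finset.erase_subset _ _).trans hCE, ?_⟩, hj⟩, hCE hxC,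
          Finset.notMem_erase _ _⟩
        rw [Finset.card_erase_of_mem hxC, hCc]
      · rintro ⟨Y, x⟩ h
        simp only [Finset.mem_sigma, Finset.mem_sdiff] at h
        simp only [Finset.erase_insert h.2.2]
      · rintro ⟨C, x⟩ h
        simp only [Finset.mem_sigma, Finset.mem_filter] at h
        simp only [Finset.insert_erase h.2.1]
      · rintro ⟨Y, x⟩ h
        rfl
    have h2 : ∀ C ∈ Finset.powersetCard m E,
        ∑ x ∈ C.filter (fun x => ((C.erase x) ∩ L).card = j), H C =
        (if (C ∩ L).card = j + 1 then ((j + 1 : ℕ) : K) * H C else 0) +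
        (if (C ∩ L).card = j then ((m - j : ℕ) : K) * H C else 0) := by
      intro C hC
      rw [Finset.mem_powersetCard] at hC
      rw [Finset.sum_const, nsmul_eq_mul]
      have herase : ∀ x ∈ C, ((C.erase x) ∩ L).card =
          if x ∈ L then (C ∩ L).card - 1 else (C ∩ L).card := by
        intro x hx
        rw [Finset.erase_inter]
        split_ifs with hxL
        · rw [Finset.card_erase_of_mem (Finset.mem_inter.2 ⟨hx, hxL⟩)]
        · rw [Finset.erase_eq_of_notMem fun h => hxL (Finset.mem_inter.1 h).2]
      have hpos : ∀ x ∈ C, x ∈ L → 0 < (C ∩ L).card := fun x hx hxL =>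
        Finset.card_pos.2 ⟨x, Finset.mem_inter.2 ⟨hx, hxL⟩⟩
      have hcard := Finset.card_sdiff_add_card_inter C L
      by_cases ha : (C ∩ L).card = j + 1
      · have : C.filter (fun x => ((C.erase x) ∩ L).card = j) = C ∩ L := by
          ext x
          simp only [Finset.mem_filter, Finset.mem_inter]
          refine and_congr_right fun hx => ?_
          rw [herase x hx]
          split_ifs with hxL
          · simp only [hxL, iff_true]; omega
          · simp only [hxL, iff_false]; omega
        rw [this, ha, if_pos rfl, if_neg (by omega), add_zero]
      · by_cases hb : (C ∩ L).card = j
        · have : C.filter (fun x => ((C.erase x) ∩ L).card = j) = C \ L := by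
            ext x
            simp only [Finset.mem_filter, Finset.mem_sdiff]
            refine and_congr_right fun hx => ?_
            rw [herase x hx]
            split_ifs with hxL
            · have := hpos x hx hxL
              simp only [hxL, not_true, iff_false]; omega
            · simp only [hxL, not_false_eq_true, iff_true]; omega
          rw [this, if_neg ha, if_pos hb, zero_add]
          congr 2
          omega
        · have : C.filter (fun x => ((C.erase x) ∩ L).card = j) = ∅ := by
            refine Finset.filter_eq_empty_iff.2 fun x hx => ?_
            rw [herase x hx]
            split_ifs with hxL
            · have := hpos x hx hxL
              omega
            · omega
          rw [this, if_neg ha, if_neg hb]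
          simp
    rw [h1, Finset.sum_congr rfl h2, Finset.sum_add_distrib, ← Finset.sum_filter,
      ← Finset.sum_filter, ← Finset.mul_sum, ← Finset.mul_sum] at h0
    exact h0
  have hind : ∀ j ≤ m, (Nat.choose m j : K) * s 0 = (-1) ^ j * s j := by
    intro j
    induction j with
    | zero => intro _; simp
    | succ j ih =>
      intro hj
      have h1 := ih (by omega)
      have h2 := hrec j (by omega)
      have h3 : (Nat.choose m (j + 1) : K) * ((j + 1 : ℕ) : K) =
          (Nat.choose m j : K) * ((m - j : ℕ) : K) := by
        rw [← Nat.cast_mul, ← Nat.cast_mul, Nat.choose_succ_right_eq]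
      refine mul_left_cancel₀ (hm j (by omega)) ?_
      rw [pow_succ]
      linear_combination s 0 * h3 + ((m - j : ℕ) : K) * h1 + (-1) ^ j * h2
  have := hind m le_rfl
  rw [Nat.choose_self, Nat.cast_one, one_mul] at this
  rw [← hsm, ← hs0, this, ← mul_assoc, ← pow_add, ← two_mul, pow_mul]
  simp

/-- A system of functions satisfying the sign-free Segre relation comes from a potential. -/
theorem exists_potential {α K : Type} [DecidableEq α] [Field K] (m : ℕ)
    (τ : Finset α → α → K) (S : Finset α)
    (hne : ∀ Y ⊆ S, Y.card = m → ∀ x ∈ S, x ∉ Y → τ Y x ≠ 0)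
    (hseg : ∀ D ⊆ S, D.card + 1 = m → ∀ x ∈ S, ∀ y ∈ S, ∀ z ∈ S, x ∉ D → y ∉ D → z ∉ D →
      x ≠ y → y ≠ z → x ≠ z →
      τ (insert x D) y * τ (insert y D) z * τ (insert z D) x =
        τ (insert y D) x * τ (insert z D) y * τ (insert x D) z) :
    ∃ g : Finset α → K, (∀ C ⊆ S, C.card = m + 1 → g C ≠ 0) ∧
      ∀ Y ⊆ S, Y.card = m → ∀ x ∈ S, x ∉ Y → ∀ y ∈ S, y ∉ Y →
        g (insert x Y) * τ Y y = g (insert y Y) * τ Y x := by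
  induction S using Finset.induction_on with
  | empty => exact ⟨fun _ => 1, by simp, by simp⟩
  | insert w X hw ih =>
    have hXS : X ⊆ insert w X := Finset.subset_insert _ _
    obtain ⟨g, hg0, hg⟩ := ih
      (fun Y hY hc x hx hxY => hne Y (hY.trans hXS) hc x (hXS hx) hxY)
      (fun D hD hc x hx y hy z hz => hseg D (hD.trans hXS) hc x (hXS hx) y (hXS hy) z (hXS hz))
    by_cases hcard : X.card ≤ m
    · refine ⟨fun _ => 1, by simp, ?_⟩
      intro Y hY hYc x hx hxY y hy hyY
      suffices x = y by rw [this]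
      by_contra hxy
      have : (insert x (insert y Y)).card ≤ (insert w X).card :=
        Finset.card_le_card (Finset.insert_subset hx (Finset.insert_subset hy hY))
      rw [Finset.card_insert_of_notMem (by simp [hxy, hxY]), Finset.card_insert_of_notMem hyY,
        Finset.card_insert_of_notMem hw] at this
      omega
    · classical
      let g' : Finset α → K := fun C =>
        if w ∈ C then
          if h : ∃ x ∈ X, x ∉ C then
            g (insert h.choose (C.erase w)) * τ (C.erase w) w / τ (C.erase w) h.choose
          else 1
        else g C
      have hg'X : ∀ C, w ∉ C → g' C = g C := fun C hC => if_neg hC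
      have hgw : ∀ Y ⊆ X, Y.card = m → ∃ x ∈ X, x ∉ Y ∧
          g' (insert w Y) = g (insert x Y) * τ Y w / τ Y x := by
        intro Y hY hYc
        have hwY : w ∉ Y := fun h => hw (hY h)
        have hex : ∃ x ∈ X, x ∉ insert w Y := by
          obtain ⟨x, hx, hxY⟩ := Finset.exists_mem_notMem_of_card_lt_card
            (show Y.card < X.card by omega)
          refine ⟨x, hx, ?_⟩
          rw [Finset.mem_insert, not_or]
          exact ⟨fun h => hw (h ▸ hx), hxY⟩
        refine ⟨hex.choose, hex.choose_spec.1,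
          fun h => hex.choose_spec.2 (Finset.mem_insert_of_mem h), ?_⟩
        simp only [g', Finset.mem_insert_self, if_true, dif_pos hex, Finset.erase_insert hwY]
      have hgw' : ∀ Y ⊆ X, Y.card = m → ∀ x ∈ X, x ∉ Y →
          g' (insert w Y) * τ Y x = g (insert x Y) * τ Y w := by
        intro Y hY hYc x hx hxY
        obtain ⟨y, hy, hyY, h⟩ := hgw Y hY hYc
        have hy0 := hne Y (hY.trans hXS) hYc y (hXS hy) hyY
        have := hg Y hY hYc x hx hxY y hy hyY
        rw [h]
        field_simp
        linear_combination -τ Y w * this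
      refine ⟨g', ?_, ?_⟩
      · intro C hC hCc
        by_cases hwC : w ∈ C
        · have hY : C.erase w ⊆ X := by
            rwa [← Finset.subset_insert_iff]
          have hYc : (C.erase w).card = m := by rw [Finset.card_erase_of_mem hwC]; omega
          obtain ⟨y, hy, hyY, h⟩ := hgw _ hY hYc
          rw [Finset.insert_erase hwC] at h
          rw [h]
          refine div_ne_zero (mul_ne_zero (hg0 _ (Finset.insert_subset hy hY) ?_)
            (hne _ (hY.trans hXS) hYc w (Finset.mem_insert_self _ _) (Finset.notMem_erase _ _)))
            (hne _ (hY.trans hXS) hYc y (hXS hy) hyY)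
          rw [Finset.card_insert_of_notMem hyY, hYc]
        · rw [hg'X C hwC]
          exact hg0 C ((Finset.subset_insert_iff_of_notMem hwC).1 hC) hCc
      · intro Y hY hYc x hx hxY y hy hyY
        by_cases hxy : x = y
        · rw [hxy]
        by_cases hwY : w ∈ Y
        · have hxX : x ∈ X := Finset.mem_of_mem_insert_of_ne hx fun h => hxY (h ▸ hwY)
          have hyX : y ∈ X := Finset.mem_of_mem_insert_of_ne hy fun h => hyY (h ▸ hwY)
          obtain ⟨D, hwD, rfl⟩ : ∃ D, w ∉ D ∧ insert w D = Y :=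
            ⟨Y.erase w, Finset.notMem_erase _ _, Finset.insert_erase hwY⟩
          have hDX : D ⊆ X := (Finset.subset_insert_iff_of_notMem hwD).1
            ((Finset.subset_insert _ _).trans hY)
          rw [Finset.card_insert_of_notMem hwD] at hYc
          rw [Finset.mem_insert, not_or] at hxY hyY
          have hDx := hgw' (insert x D) (Finset.insert_subset hxX hDX)
            (by rw [Finset.card_insert_of_notMem hxY.2, hYc]) y hyX
            (by simp [Ne.symm hxy, hyY.2])
          have hDy := hgw' (insert y D) (Finset.insert_subset hyX hDX)
            (by rw [Finset.card_insert_of_notMem hyY.2, hYc]) x hxX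
            (by simp [hxy, hxY.2])
          have hsg := hseg D (hDX.trans hXS) hYc x hx y hy w (Finset.mem_insert_self _ _)
            hxY.2 hyY.2 hwD hxy hyY.1 hxY.1
          have h1 := hne (insert x D) ((Finset.insert_subset hxX hDX).trans hXS)
            (by rw [Finset.card_insert_of_notMem hxY.2, hYc]) y hy (by simp [Ne.symm hxy, hyY.2])
          have h2 := hne (insert y D) ((Finset.insert_subset hyX hDX).trans hXS)
            (by rw [Finset.card_insert_of_notMem hyY.2, hYc]) x hx (by simp [hxy, hxY.2])
          rw [Finset.insert_comm x w, Finset.insert_comm y w]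
          rw [Finset.insert_comm y x] at hDx
          refine mul_left_cancel₀ (mul_ne_zero h1 h2) ?_
          linear_combination τ (insert y D) x * τ (insert w D) y * hDx
            - τ (insert x D) y * τ (insert w D) x * hDy
            - g (insert x (insert y D)) * hsg
        · have hYX : Y ⊆ X := (Finset.subset_insert_iff_of_notMem hwY).1 hY
          by_cases hxw : x = w
          · subst hxw
            have hyX : y ∈ X := Finset.mem_of_mem_insert_of_ne hy (Ne.symm hxy)
            rw [hgw' Y hYX hYc y hyX hyY, hg'X]
            simp [hxy, hwY]
          · have hxX : x ∈ X := Finset.mem_of_mem_insert_of_ne hx hxw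
            by_cases hyw : y = w
            · subst hyw
              rw [hgw' Y hYX hYc x hxX hxY, hg'X]
              simp [Ne.symm hxy, hwY]
            · have hyX : y ∈ X := Finset.mem_of_mem_insert_of_ne hy hyw
              rw [hg'X _ (by simp [Ne.symm hxw, hwY]), hg'X _ (by simp [Ne.symm hyw, hwY])]
              exact hg Y hYX hYc x hxX hxY y hyX hyY

/-- Homogeneous interpolation: `br` plays the role of a `2 × 2` determinant and the `φ i` are
linear forms in two variables. -/
theorem sum_prod_mul_prod_inv_eq_zero {α ι K : Type} [DecidableEq α] [Field K]
    (br : α → α → K) (hself : ∀ u, br u u = 0)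
    (hanti : ∀ u v, br u v = -br v u) (φ : ι → α → K) (Φ : Finset ι) :
    ∀ E : Finset α, E.card = Φ.card + 2 → (∀ u ∈ E, ∀ v ∈ E, u ≠ v → br u v ≠ 0) →
      (∀ i ∈ Φ, ∀ x ∈ E, ∀ u ∈ E, ∀ v ∈ E, u ≠ v →
        φ i x * br u v = φ i u * br x v + φ i v * br u x) →
      ∑ x ∈ E, (∏ i ∈ Φ, φ i x) * ∏ z ∈ E.erase x, (br z x)⁻¹ = 0 := by
  classical
  induction Φ using Finset.induction_on with
  | empty =>
    intro E hE _ _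
    obtain ⟨u, v, huv, rfl⟩ := Finset.card_eq_two.1 hE
    have h1 : ({u, v} : Finset α).erase u = {v} := by
      rw [Finset.erase_insert (by simpa using huv)]
    have h2 : ({u, v} : Finset α).erase v = {u} := by
      rw [Finset.pair_comm, Finset.erase_insert (by simpa using huv.symm)]
    rw [Finset.sum_pair huv, h1, h2, Finset.prod_singleton, Finset.prod_singleton, hanti u v]
    simp
  | insert i Φ hi ih =>
    intro E hE hne hrel
    rw [Finset.card_insert_of_notMem hi] at hE
    have key : ∀ v ∈ E, ∑ x ∈ E, (∏ i ∈ Φ, φ i x) * br x v *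
        ∏ z ∈ E.erase x, (br z x)⁻¹ = 0 := by
      intro v hv
      have h0 := ih (E.erase v) (by rw [Finset.card_erase_of_mem hv]; omega)
        (fun u hu w hw => hne u (Finset.mem_of_mem_erase hu) w (Finset.mem_of_mem_erase hw))
        (fun j hj x hx u hu w hw => hrel j (Finset.mem_insert_of_mem hj) x
          (Finset.mem_of_mem_erase hx) u (Finset.mem_of_mem_erase hu) w
          (Finset.mem_of_mem_erase hw))
      rw [← Finset.add_sum_erase E _ hv, hself, mul_zero, zero_mul, zero_add, ← neg_eq_zero,
        ← Finset.sum_neg_distrib, ← h0]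
      refine Finset.sum_congr rfl fun x hx => ?_
      have hxv := Finset.ne_of_mem_erase hx
      have hb := hne v hv x (Finset.mem_of_mem_erase hx) hxv.symm
      rw [← Finset.mul_prod_erase (E.erase x) _ (Finset.mem_erase.2 ⟨hxv.symm, hv⟩),
        Finset.erase_right_comm, hanti x v]
      field_simp
    obtain ⟨u, hu, v, hv, huv⟩ := Finset.one_lt_card.1 (by omega : 1 < E.card)
    refine (mul_eq_zero.1 (?_ : br u v * _ = 0)).resolve_left (hne u hu v hv huv)
    calc _ = φ i u * ∑ x ∈ E, (∏ i ∈ Φ, φ i x) * br x v * ∏ z ∈ E.erase x, (br z x)⁻¹ -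
          φ i v * ∑ x ∈ E, (∏ i ∈ Φ, φ i x) * br x u * ∏ z ∈ E.erase x, (br z x)⁻¹ := by
          rw [Finset.mul_sum, Finset.mul_sum, Finset.mul_sum, ← Finset.sum_sub_distrib]
          refine Finset.sum_congr rfl fun x hx => ?_
          rw [Finset.prod_insert hi]
          linear_combination ((∏ i ∈ Φ, φ i x) * ∏ z ∈ E.erase x, (br z x)⁻¹) *
            (hrel i (Finset.mem_insert_self _ _) x hx u hu v hv huv + φ i v * hanti u x)
      _ = 0 := by rw [key v hv, key u hu, mul_zero, mul_zero, sub_zero]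

theorem detCols_cons {K : Type} [CommRing K] {k : ℕ} (l : List (Fin (k + 1) → K))
    (x : Fin (k + 1) → K) :
    detCols (x :: l) =
      (Matrix.updateCol (Matrix.of fun i j : Fin (k + 1) => (0 :: l).getD (j : ℕ) 0 i) 0 x).det := by
  unfold detCols
  congr 1
  ext i j
  refine Fin.cases ?_ (fun j => ?_) j <;> simp

/-- `detCols` as a linear form in the first column. -/
def detColsForm {K : Type} [CommRing K] {k : ℕ} (hk : 0 < k) (l : List (Fin k → K)) :
    (Fin k → K) →ₗ[K] K where
  toFun x := detCols (x :: l)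
  map_add' x y := by
    obtain ⟨k, rfl⟩ := Nat.exists_eq_succ_of_ne_zero hk.ne'
    simp only [detCols_cons, Matrix.det_updateCol_add]
  map_smul' c x := by
    obtain ⟨k, rfl⟩ := Nat.exists_eq_succ_of_ne_zero hk.ne'
    simp only [detCols_cons, Matrix.det_updateCol_smul, RingHom.id_apply, smul_eq_mul]

theorem detCols_swap {K : Type} [CommRing K] {k : ℕ} (u v : List (Fin k → K))
    (a b : Fin k → K) (h : (u ++ a :: b :: v).length = k) :
    detCols (u ++ a :: b :: v) = -detCols (u ++ b :: a :: v) := by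
  simp only [List.length_append, List.length_cons] at h
  let i : Fin k := ⟨u.length, by omega⟩
  let j : Fin k := ⟨u.length + 1, by omega⟩
  have hij : i ≠ j := by simp [i, j, Fin.ext_iff]
  have hM : (Matrix.of fun i j : Fin k => (u ++ a :: b :: v).getD (j : ℕ) 0 i) =
      (Matrix.of fun i j : Fin k => (u ++ b :: a :: v).getD (j : ℕ) 0 i).submatrix id
        (Equiv.swap i j) := by
    ext r c
    simp only [Matrix.of_apply, Matrix.submatrix_apply, id_eq]
    rw [Equiv.swap_apply_def]
    split_ifs with h1 h2
    · subst h1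
      simp [i, j]
    · subst h2
      simp [i, j]
    · have h1' : (c : ℕ) ≠ u.length := fun h => h1 (Fin.ext h)
      have h2' : (c : ℕ) ≠ u.length + 1 := fun h => h2 (Fin.ext h)
      by_cases hc : (c : ℕ) < u.length
      · rw [List.getD_append _ _ _ _ hc, List.getD_append _ _ _ _ hc]
      · rw [List.getD_append_right _ _ _ _ (by omega), List.getD_append_right _ _ _ _ (by omega)]
        obtain ⟨m, hm⟩ : ∃ m, (c : ℕ) - u.length = m + 2 := ⟨c - u.length - 2, by omega⟩
        rw [hm]
        simp
  unfold detCols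
  rw [hM, Matrix.det_permute', Equiv.Perm.sign_swap hij]
  simp

theorem detCols_eq_zero_of_mem {K : Type} [CommRing K] {k : ℕ} (l : List (Fin k → K))
    (x : Fin k → K) (hl : l.length + 1 = k) (hx : x ∈ l) : detCols (x :: l) = 0 := by
  obtain ⟨i, hi, rfl⟩ := List.mem_iff_getElem.1 hx
  refine Matrix.det_zero_of_column_eq (i := ⟨0, by omega⟩) (j := ⟨i + 1, by omega⟩)
    (by simp) fun r => ?_
  simp [hi]

theorem detCols_ne_zero {K : Type} [Field K] [DecidableEq K] {k : ℕ} (l : List (Fin k → K))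
    (hl : l.length = k) (hnd : l.Nodup)
    (hli : LinearIndependent K (fun v : {x // x ∈ l.toFinset} => (v : Fin k → K))) :
    detCols l ≠ 0 := by
  have hmem : ∀ j : Fin k, l.getD j 0 ∈ l.toFinset := fun j => by
    rw [List.mem_toFinset, List.getD_eq_getElem _ _ (by omega)]
    exact List.getElem_mem _
  have h2 : LinearIndependent K
      (Matrix.of fun i j : Fin k => l.getD (j : ℕ) 0 i).col := by
    have := hli.comp (fun j : Fin k => ⟨l.getD j 0, hmem j⟩) (by
      intro i j hij
      have hij' := congrArg Subtype.val hij
      simp only at hij'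
      rw [List.getD_eq_getElem _ _ (by omega), List.getD_eq_getElem _ _ (by omega),
        hnd.getElem_inj_iff] at hij'
      exact Fin.ext hij')
    exact this
  rw [Matrix.linearIndependent_cols_iff_isUnit, Matrix.isUnit_iff_isUnit_det] at h2
  exact h2.ne_zero

/-- Cramer's rule for a linear form vanishing on all but two vectors of a basis. -/
theorem form_mul_detCols {K : Type} [Field K] [DecidableEq K] {k : ℕ} (l : List (Fin k → K))
    (hl : l.length + 2 = k) (u v : Fin k → K)
    (hspan : Submodule.span K ((u :: v :: l).toFinset : Set (Fin k → K)) = ⊤)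
    (α : (Fin k → K) →ₗ[K] K) (hα : ∀ y ∈ l, α y = 0) (x : Fin k → K) :
    α x * detCols (u :: v :: l) =
      α u * detCols (x :: v :: l) + α v * detCols (u :: x :: l) := by
  have hk : 0 < k := by omega
  have hsw : ∀ a b, detCols (a :: b :: l) = -detCols (b :: a :: l) := fun a b =>
    detCols_swap [] l a b (by simpa using hl)
  have hz : ∀ a b, a ∈ b :: l → detCols (a :: b :: l) = 0 := fun a b h =>
    detCols_eq_zero_of_mem _ _ (by simpa using hl) h
  have hmaps : detCols (u :: v :: l) • α =
      α u • detColsForm hk (v :: l) - α v • detColsForm hk (u :: l) := by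
    refine LinearMap.ext_on hspan fun y hy => ?_
    simp only [LinearMap.smul_apply, LinearMap.sub_apply, smul_eq_mul, detColsForm,
      LinearMap.coe_mk, AddHom.coe_mk]
    simp only [List.coe_toFinset, Set.mem_ofPred_eq, List.mem_cons] at hy
    rcases hy with rfl | rfl | hy
    · rw [hz y y (by simp)]; ring
    · rw [hz y y (by simp), hsw u y]; ring
    · rw [hα y hy, hz y v (by simp [hy]), hz y u (by simp [hy])]; ring
  have := LinearMap.congr_fun hmaps x
  simp only [LinearMap.smul_apply, LinearMap.sub_apply, smul_eq_mul, detColsForm,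
    LinearMap.coe_mk, AddHom.coe_mk] at this
  rw [hsw u x]
  linear_combination this

/-- Every subset of `S` of size `k` is a basis. -/
def IsArc {K : Type} [Field K] {k : ℕ} (S : Finset (Fin k → K)) : Prop :=
  ∀ A ⊆ S, A.card = k →
    LinearIndependent K (fun v : {x // x ∈ A} => (v : Fin k → K)) ∧
    Submodule.span K (A : Set (Fin k → K)) = ⊤

theorem IsArc.detCols_ne_zero {K : Type} [Field K] [DecidableEq K] {k : ℕ}
    {S : Finset (Fin k → K)} (hS : IsArc S) {l : List (Fin k → K)} (hl : l.length = k)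
    (hnd : l.Nodup) (hlS : ∀ v ∈ l, v ∈ S) : detCols l ≠ 0 :=
  _root_.detCols_ne_zero l hl hnd
    (hS l.toFinset (fun v hv => hlS v (List.mem_toFinset.1 hv))
      (by rw [List.toFinset_card_of_nodup hnd, hl])).1

theorem IsArc.form_mul_detCols {K : Type} [Field K] [DecidableEq K] {k : ℕ}
    {S : Finset (Fin k → K)} (hS : IsArc S) {l : List (Fin k → K)} (hl : l.length + 2 = k)
    {u v : Fin k → K} (hnd : (u :: v :: l).Nodup) (hlS : ∀ y ∈ u :: v :: l, y ∈ S)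
    (α : (Fin k → K) →ₗ[K] K) (hα : ∀ y ∈ l, α y = 0) (x : Fin k → K) :
    α x * detCols (u :: v :: l) =
      α u * detCols (x :: v :: l) + α v * detCols (u :: x :: l) :=
  _root_.form_mul_detCols l hl u v
    (hS _ (fun v hv => hlS v (List.mem_toFinset.1 hv))
      (by rw [List.toFinset_card_of_nodup hnd]; simpa using hl)).2 α hα x

theorem IsTangentFamily.apply_ne_zero {K : Type} [Field K] [DecidableEq K] {k t : ℕ}
    {S : Finset (Fin k → K)} {T : Finset (Fin k → K) → (Fin k → K) → K}
    (hT : IsTangentFamily t S T) {Y : Finset (Fin k → K)} (hY : Y ⊆ S) (hYc : Y.card = k - 2)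
    {x : Fin k → K} (hx : x ∈ S) (hxY : x ∉ Y) : T Y x ≠ 0 := by
  obtain ⟨Φ, -, -, -, hne, hprod⟩ := hT Y hY hYc
  rw [hprod, Finset.prod_ne_zero_iff]
  exact fun α hα => hne α hα x hx hxY

/-- Interpolation of a tangent function. -/
theorem sum_tangent_mul_prod_inv_eq_zero {K : Type} [Field K] [DecidableEq K] {k t : ℕ}
    {S : Finset (Fin k → K)} (hS : IsArc S) {T : Finset (Fin k → K) → (Fin k → K) → K}
    (hT : IsTangentFamily t S T) {l : List (Fin k → K)} (hl : l.length + 2 = k)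
    (hnd : l.Nodup) (hlS : ∀ v ∈ l, v ∈ S) (E : Finset (Fin k → K)) (hES : E ⊆ S)
    (hEl : ∀ x ∈ E, x ∉ l) (hE : E.card = t + 2) :
    ∑ x ∈ E, T l.toFinset x * ∏ z ∈ E.erase x, (detCols (z :: x :: l))⁻¹ = 0 := by
  obtain ⟨Φ, hΦ, -, hvan, -, hprod⟩ := hT l.toFinset
    (fun v hv => hlS v (List.mem_toFinset.1 hv))
    (by rw [List.toFinset_card_of_nodup hnd]; omega)
  have hnd' : ∀ u ∈ E, ∀ v ∈ E, u ≠ v → (u :: v :: l).Nodup := fun u hu v hv huv => by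
    simp [hEl u hu, hEl v hv, huv, hnd]
  have hmem : ∀ u ∈ E, ∀ v ∈ E, ∀ y ∈ u :: v :: l, y ∈ S := fun u hu v hv y hy => by
    simp only [List.mem_cons] at hy
    rcases hy with rfl | rfl | hy
    exacts [hES hu, hES hv, hlS _ hy]
  simp only [hprod]
  refine sum_prod_mul_prod_inv_eq_zero (fun u v => detCols (u :: v :: l))
    (fun u => detCols_eq_zero_of_mem _ _ (by simpa using hl) (by simp))
    (fun u v => detCols_swap [] l u v (by simpa using hl))
    (fun (α : (Fin k → K) →ₗ[K] K) x => α x) Φ E (by rw [hE, hΦ]) ?_ ?_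
  · exact fun u hu v hv huv => hS.detCols_ne_zero (by simpa using hl) (hnd' u hu v hv huv)
      (hmem u hu v hv)
  · exact fun α hα x _ u hu v hv huv => hS.form_mul_detCols hl (hnd' u hu v hv huv)
      (hmem u hu v hv) α (fun y hy => hvan α hα y (List.mem_toFinset.2 hy)) x

/-- The hyperplanes through `l` other than the two containing `y` or `z` are the tangents and
those spanned by `l` and another point of `S`, so the corresponding ratios run through all the
nonzero elements of the field. -/
theorem prod_detCols_div_mul_tangent {K : Type} [Field K] [Fintype K] [DecidableEq K] {k t : ℕ}
    {S : Finset (Fin k → K)} (hS : IsArc S) (hcard : S.card + t = Fintype.card K + k - 1)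
    {T : Finset (Fin k → K) → (Fin k → K) → K}
    (hT : IsTangentFamily t S T) {l : List (Fin k → K)} (hl : l.length + 2 = k)
    {y z : Fin k → K} (hnd : (y :: z :: l).Nodup) (hlS : ∀ v ∈ y :: z :: l, v ∈ S) :
    (∏ s ∈ S \ (y :: z :: l).toFinset, detCols (y :: s :: l) / detCols (s :: z :: l)) *
      ((-1) ^ t * T l.toFinset y) = -T l.toFinset z := by
  have hyS : y ∈ S := hlS y (by simp)
  have hzS : z ∈ S := hlS z (by simp)
  have hndl : l.Nodup := by simp only [List.nodup_cons] at hnd; exact hnd.2.2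
  have hlS' : ∀ v ∈ l, v ∈ S := fun v hv => hlS v (by simp [hv])
  have hyl : y ∉ l := fun h => by simp [h] at hnd
  have hzl : z ∉ l := fun h => by simp [h] at hnd
  have hlsub : l.toFinset ⊆ S := fun v hv => hlS' v (List.mem_toFinset.1 hv)
  obtain ⟨Φ, hΦ, hind, hvan, hne, hprod⟩ := hT l.toFinset hlsub
    (by rw [List.toFinset_card_of_nodup hndl]; omega)
  have hvan' : ∀ α ∈ Φ, ∀ v ∈ l, α v = 0 := fun α hα v hv =>
    hvan α hα v (List.mem_toFinset.2 hv)
  have hy0 : ∀ α ∈ Φ, α y ≠ 0 := fun α hα => hne α hα y hyS (by simpa using hyl)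
  have hz0 : ∀ α ∈ Φ, α z ≠ 0 := fun α hα => hne α hα z hzS (by simpa using hzl)
  have hk : 0 < k := by omega
  have hbr : ∀ a ∈ S, ∀ b ∈ S, a ∉ l → b ∉ l → a ≠ b → detCols (a :: b :: l) ≠ 0 := by
    intro a ha b hb hal hbl hab
    refine hS.detCols_ne_zero (by simpa using hl) (by simp [hal, hbl, hab, hndl]) ?_
    intro v hv
    simp only [List.mem_cons] at hv
    rcases hv with rfl | rfl | hv
    exacts [ha, hb, hlS' _ hv]
  have hsw : ∀ a b, detCols (a :: b :: l) = -detCols (b :: a :: l) := fun a b =>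
    detCols_swap [] l a b (by simpa using hl)
  have hyz : y ≠ z := fun h => by simp [h] at hnd
  have hyz0 := hbr y hyS z hzS hyl hzl hyz
  have hform := fun α (hα : ∀ v ∈ l, α v = 0) x => hS.form_mul_detCols hl hnd hlS α hα x
  set S' := S \ (y :: z :: l).toFinset with hS'
  have hS'mem : ∀ s ∈ S', s ∈ S ∧ s ≠ y ∧ s ≠ z ∧ s ∉ l := by
    intro s hs
    simpa [hS', not_or] using hs
  have hys : ∀ s ∈ S', detCols (y :: s :: l) ≠ 0 := fun s hs => by
    obtain ⟨h1, h2, h3, h4⟩ := hS'mem s hs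
    exact hbr y hyS s h1 hyl h4 h2.symm
  have hsz : ∀ s ∈ S', detCols (s :: z :: l) ≠ 0 := fun s hs => by
    obtain ⟨h1, h2, h3, h4⟩ := hS'mem s hs
    exact hbr s h1 z hzS h4 hzl h3
  let f : {s // s ∈ S'} ⊕ {α // α ∈ Φ} → Kˣ := Sum.elim
    (fun s => Units.mk0 (detCols (y :: s.1 :: l) / detCols (s.1 :: z :: l))
      (div_ne_zero (hys _ s.2) (hsz _ s.2)))
    (fun α => Units.mk0 (-1 * α.1 y / α.1 z)
      (div_ne_zero (mul_ne_zero (neg_ne_zero.2 one_ne_zero) (hy0 _ α.2)) (hz0 _ α.2)))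
  have hmixed : ∀ s ∈ S', ∀ α ∈ Φ,
      detCols (y :: s :: l) / detCols (s :: z :: l) ≠ -1 * α y / α z := by
    intro s hs α hα h
    rw [div_eq_div_iff (hsz s hs) (hz0 α hα)] at h
    have h1 := hform α (hvan' α hα) s
    have h2 := hne α hα s (hS'mem s hs).1 (by simpa using (hS'mem s hs).2.2.2)
    exact mul_ne_zero h2 hyz0 (by linear_combination h1 + h)
  have hinj : Function.Injective f := by
    rintro (⟨s, hs⟩ | ⟨α, hα⟩) (⟨s', hs'⟩ | ⟨β, hβ⟩) h
    · have h := congrArg Units.val h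
      simp only [f, Sum.elim_inl, Units.val_mk0] at h
      rw [div_eq_div_iff (hsz s hs) (hsz s' hs')] at h
      congr 2
      by_contra hss
      have h1 := hform (detColsForm hk (s' :: l))
        (fun v hv => detCols_eq_zero_of_mem _ _ (by simpa using hl) (by simp [hv])) s
      simp only [detColsForm, LinearMap.coe_mk, AddHom.coe_mk] at h1
      refine mul_ne_zero (hbr s (hS'mem s hs).1 s' (hS'mem s' hs').1 (hS'mem s hs).2.2.2
        (hS'mem s' hs').2.2.2 hss) hyz0 ?_
      rw [h1, hsw z s']
      linear_combination -h
    · exact absurd (congrArg Units.val h) (hmixed s hs β hβ)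
    · exact absurd (congrArg Units.val h).symm (hmixed s' hs' α hα)
    · have h := congrArg Units.val h
      simp only [f, Sum.elim_inr, Units.val_mk0] at h
      rw [div_eq_div_iff (hz0 α hα) (hz0 β hβ)] at h
      congr 2
      by_contra hab
      refine hind α hα β hβ hab (α z / β z) (LinearMap.ext fun x => ?_)
      have h1 := hform α (hvan' α hα) x
      have h2 := hform β (hvan' β hβ) x
      rw [LinearMap.smul_apply, smul_eq_mul, div_mul_eq_mul_div, eq_div_iff (hz0 β hβ)]
      refine mul_right_cancel₀ hyz0 ?_
      linear_combination β z * h1 - α z * h2 - detCols (x :: z :: l) * h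
  have hcardeq : Fintype.card ({s // s ∈ S'} ⊕ {α // α ∈ Φ}) = Fintype.card Kˣ := by
    have h1 : S'.card = S.card - k := by
      rw [hS', Finset.card_sdiff_of_subset (fun v hv => hlS v (List.mem_toFinset.1 hv)),
        List.toFinset_card_of_nodup hnd]
      simp [hl]
    have h2 : k ≤ S.card := by
      have := Finset.card_le_card
        (fun v hv => hlS v (List.mem_toFinset.1 hv) : (y :: z :: l).toFinset ⊆ S)
      rw [List.toFinset_card_of_nodup hnd] at this
      simpa [hl] using this
    rw [Fintype.card_sum, Fintype.card_coe, Fintype.card_coe, h1, hΦ, Fintype.card_units]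
    omega
  have hbij := (Fintype.bijective_iff_injective_and_card f).2 ⟨hinj, hcardeq⟩
  have hprodf : ∏ i, f i = -1 := by
    rw [← FiniteField.prod_univ_units_id_eq_neg_one]
    exact Fintype.prod_bijective f hbij _ _ fun _ => rfl
  have hΦprod : ∏ α ∈ Φ, -1 * α y / α z = (-1) ^ t * T l.toFinset y / T l.toFinset z := by
    rw [Finset.prod_div_distrib, Finset.prod_mul_distrib, Finset.prod_const, hΦ, hprod, hprod]
  have hval := congrArg Units.val hprodf
  rw [Units.coe_prod, Fintype.prod_sum_type] at hval
  simp only [f, Sum.elim_inl, Sum.elim_inr, Units.val_mk0, Units.val_neg, Units.val_one] at hval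
  rw [Finset.prod_coe_sort S' (fun s => detCols (y :: s :: l) / detCols (s :: z :: l)),
    Finset.prod_coe_sort Φ (fun α => -1 * α y / α z), hΦprod] at hval
  have hTz : T l.toFinset z ≠ 0 := by
    rw [hprod, Finset.prod_ne_zero_iff]
    exact hz0
  rw [← mul_div_assoc, div_eq_iff hTz] at hval
  rw [hval, neg_one_mul]

/-- Segre's lemma of tangents. -/
theorem segre_tangents {K : Type} [Field K] [Fintype K] [DecidableEq K] {k t : ℕ}
    {S : Finset (Fin k → K)} (hS : IsArc S) (hcard : S.card + t = Fintype.card K + k - 1)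
    {T : Finset (Fin k → K) → (Fin k → K) → K}
    (hT : IsTangentFamily t S T) {l : List (Fin k → K)} (hl : l.length + 3 = k)
    {x y z : Fin k → K} (hnd : (x :: y :: z :: l).Nodup)
    (hlS : ∀ v ∈ x :: y :: z :: l, v ∈ S) :
    T (insert x l.toFinset) y * T (insert y l.toFinset) z * T (insert z l.toFinset) x =
      (-1) ^ (t + 1) * (T (insert y l.toFinset) x * T (insert z l.toFinset) y *
        T (insert x l.toFinset) z) := by
  simp only [List.nodup_cons, List.mem_cons, not_or] at hnd
  obtain ⟨⟨hxy, hxz, hxl⟩, ⟨hyz, hyl⟩, hzl, hndl⟩ := hnd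
  have hlS' : ∀ v, (v = x ∨ v = y ∨ v = z ∨ v ∈ l) → v ∈ S := by simpa using hlS
  have h1 := prod_detCols_div_mul_tangent hS hcard hT (l := x :: l) (by simpa using hl)
    (y := y) (z := z) (by simp [hndl, hyz, hyl, hzl, hxl, Ne.symm hxy, Ne.symm hxz])
    (fun v hv => hlS' v (by simp only [List.mem_cons] at hv; tauto))
  have h2 := prod_detCols_div_mul_tangent hS hcard hT (l := y :: l) (by simpa using hl)
    (y := z) (z := x) (by simp [hndl, hyl, hzl, hxl, hxy, Ne.symm hyz, Ne.symm hxz])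
    (fun v hv => hlS' v (by simp only [List.mem_cons] at hv; tauto))
  have h3 := prod_detCols_div_mul_tangent hS hcard hT (l := z :: l) (by simpa using hl)
    (y := x) (z := y) (by simp [hndl, hyl, hzl, hxl, hxy, hxz, hyz])
    (fun v hv => hlS' v (by simp only [List.mem_cons] at hv; tauto))
  have e1 : (y :: z :: x :: l).toFinset = (x :: y :: z :: l).toFinset := by ext v; simp; tauto
  have e2 : (z :: x :: y :: l).toFinset = (x :: y :: z :: l).toFinset := by ext v; simp; tauto
  rw [e1] at h1
  rw [e2] at h2
  simp only [List.toFinset_cons] at h1 h2 h3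
  set S' := S \ insert x (insert y (insert z l.toFinset))
  have hrot : ∀ a b c, detCols (a :: b :: c :: l) = detCols (c :: a :: b :: l) := by
    intro a b c
    have h1 := detCols_swap [a] l b c (by simpa using hl)
    have h2 := detCols_swap [] (b :: l) a c (by simpa using hl)
    simp only [List.singleton_append, List.nil_append] at h1 h2
    rw [h1, h2, neg_neg]
  have hprod : (∏ s ∈ S', detCols (y :: s :: x :: l) / detCols (s :: z :: x :: l)) *
      (∏ s ∈ S', detCols (z :: s :: y :: l) / detCols (s :: x :: y :: l)) *
      (∏ s ∈ S', detCols (x :: s :: z :: l) / detCols (s :: y :: z :: l)) = 1 := by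
    rw [← Finset.prod_mul_distrib, ← Finset.prod_mul_distrib]
    refine Finset.prod_eq_one fun s hs => ?_
    simp only [S', Finset.mem_sdiff, Finset.mem_insert, List.mem_toFinset, not_or] at hs
    obtain ⟨hsS, hsx, hsy, hsz, hsl⟩ := hs
    have hbr : ∀ a b, (a = x ∨ a = y ∨ a = z) → (b = x ∨ b = y ∨ b = z) → a ≠ b →
        detCols (s :: a :: b :: l) ≠ 0 := by
      intro a b ha hb hab
      refine hS.detCols_ne_zero (by simpa using hl) ?_ ?_
      · simp only [List.nodup_cons, List.mem_cons, not_or]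
        refine ⟨⟨?_, ?_, hsl⟩, ⟨hab, ?_⟩, ?_, hndl⟩
        · rcases ha with rfl | rfl | rfl <;> assumption
        · rcases hb with rfl | rfl | rfl <;> assumption
        · rcases ha with rfl | rfl | rfl <;> assumption
        · rcases hb with rfl | rfl | rfl <;> assumption
      · intro v hv
        simp only [List.mem_cons] at hv
        rcases hv with rfl | rfl | rfl | hv
        · exact hsS
        · exact hlS' _ (by tauto)
        · exact hlS' _ (by tauto)
        · exact hlS' _ (by tauto)
    have n1 := hbr z x (by tauto) (by tauto) (Ne.symm hxz)
    have n2 := hbr x y (by tauto) (by tauto) hxy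
    have n3 := hbr y z (by tauto) (by tauto) hyz
    rw [← hrot s x y, ← hrot s y z, ← hrot s z x]
    field_simp
  have hpow : ((-1 : K) ^ t) * (-1) ^ t = 1 := by rw [← pow_add, ← two_mul, pow_mul]; simp
  generalize (∏ s ∈ S', detCols (y :: s :: x :: l) / detCols (s :: z :: x :: l)) = Q1 at *
  generalize (∏ s ∈ S', detCols (z :: s :: y :: l) / detCols (s :: x :: y :: l)) = Q2 at *
  generalize (∏ s ∈ S', detCols (x :: s :: z :: l) / detCols (s :: y :: z :: l)) = Q3 at *
  have hall : (Q1 * ((-1) ^ t * T (insert x l.toFinset) y)) *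
      (Q2 * ((-1) ^ t * T (insert y l.toFinset) z)) *
      (Q3 * ((-1) ^ t * T (insert z l.toFinset) x)) =
      -(T (insert x l.toFinset) z * T (insert y l.toFinset) x * T (insert z l.toFinset) y) := by
    rw [h1, h2, h3]; ring
  rw [pow_succ]
  generalize (-1 : K) ^ t = e at *
  linear_combination e * hall - (T (insert x l.toFinset) y * T (insert y l.toFinset) z *
    T (insert z l.toFinset) x) * (e ^ 4 * hprod + (e * e + 1) * hpow)

theorem detCols_ite_swap {K : Type} [CommRing K] {k : ℕ} (z : Fin k → K)
    (u : List (Fin k → K)) (a b : Fin k → K) (v : List (Fin k → K)) :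
    (if (u ++ a :: b :: v).length + 1 = k then detCols (z :: (u ++ a :: b :: v)) else 0) =
      -1 * if (u ++ b :: a :: v).length + 1 = k then detCols (z :: (u ++ b :: a :: v)) else 0 := by
  have hlen : (u ++ b :: a :: v).length = (u ++ a :: b :: v).length := by simp
  rw [hlen]
  split_ifs with h
  · have := detCols_swap (z :: u) v a b (by simpa using h)
    simpa using this
  · simp

theorem exists_pow_of_perm_detCols {K : Type} [CommRing K] {k : ℕ} {l l' : List (Fin k → K)}
    (h : l.Perm l') (hl : l.length + 1 = k) :
    ∃ N : ℕ, (∀ z, detCols (z :: l) = (-1) ^ N * detCols (z :: l')) ∧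
      ∀ (f : List (Fin k → K) → K) (c : K),
        (∀ u a b v, f (u ++ a :: b :: v) = c * f (u ++ b :: a :: v)) → f l = c ^ N * f l' := by
  obtain ⟨N, hN⟩ := exists_pow_of_perm h
  refine ⟨N, fun z => ?_, fun f c hf => hN K f c hf []⟩
  have := hN K (fun l => if l.length + 1 = k then detCols (z :: l) else 0) (-1)
    (detCols_ite_swap z) []
  simpa [← h.length_eq, hl] using this

/-- An alternating function of `k - 1` vectors which does not vanish on tuples from an arc. -/
theorem IsArc.exists_alternating {K : Type} [Field K] [DecidableEq K] {k : ℕ}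
    {S : Finset (Fin k → K)} (hS : IsArc S) (hSk : k ≤ S.card) :
    ∃ δ : List (Fin k → K) → K,
      (∀ u a b v, δ (u ++ a :: b :: v) = -1 * δ (u ++ b :: a :: v)) ∧
      ∀ l : List (Fin k → K), l.Nodup → (∀ v ∈ l, v ∈ S) → l.length + 1 = k → δ l ≠ 0 := by
  classical
  let w : Finset (Fin k → K) → (Fin k → K) := fun C =>
    if h : ∃ z, detCols (z :: C.toList) ≠ 0 then h.choose else 0
  refine ⟨fun l => if l.length + 1 = k then detCols (w l.toFinset :: l) else 0, ?_, ?_⟩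
  · intro u a b v
    have hset : (u ++ a :: b :: v).toFinset = (u ++ b :: a :: v).toFinset := by
      ext x; simp; tauto
    simp only [hset]
    exact detCols_ite_swap _ u a b v
  · intro l hnd hlS hl
    simp only [if_pos hl]
    obtain ⟨N, hperm, -⟩ := exists_pow_of_perm_detCols (List.toFinset_toList hnd)
      (by rw [(List.toFinset_toList hnd).length_eq, hl])
    obtain ⟨z, hz, hzl⟩ : ∃ z ∈ S, z ∉ l.toFinset :=
      Finset.exists_mem_notMem_of_card_lt_card
        (by rw [List.toFinset_card_of_nodup hnd]; omega)
    have hex : ∃ z, detCols (z :: l.toFinset.toList) ≠ 0 := by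
      refine ⟨z, ?_⟩
      rw [hperm]
      refine mul_ne_zero (pow_ne_zero _ (neg_ne_zero.2 one_ne_zero))
        (hS.detCols_ne_zero (by simpa using hl) ?_ ?_)
      · exact List.nodup_cons.2 ⟨by simpa using hzl, hnd⟩
      · simpa [hz] using hlS
    have := hex.choose_spec
    rw [hperm] at this
    simp only [w, dif_pos hex]
    exact right_ne_zero_of_mul this

/-- The tangent functions can be scaled simultaneously to come from one function of `k - 1` points
of the arc which is symmetric or alternating according to the parity of `t + 1`. -/
theorem exists_tangent_potential {K : Type} [Field K] [Fintype K] [DecidableEq K] {k t : ℕ}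
    (hk : 3 ≤ k) {S : Finset (Fin k → K)} (hS : IsArc S) (hSk : k ≤ S.card)
    (hcard : S.card + t = Fintype.card K + k - 1)
    {T : Finset (Fin k → K) → (Fin k → K) → K} (hT : IsTangentFamily t S T) :
    ∃ f : List (Fin k → K) → K,
      (∀ u a b v, f (u ++ a :: b :: v) = (-1) ^ (t + 1) * f (u ++ b :: a :: v)) ∧
      (∀ l : List (Fin k → K), l.Nodup → (∀ v ∈ l, v ∈ S) → l.length + 1 = k → f l ≠ 0) ∧
      ∀ (l : List (Fin k → K)) (x y : Fin k → K), l.length + 2 = k →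
        (x :: l).Nodup → (y :: l).Nodup → (∀ v ∈ x :: y :: l, v ∈ S) →
        f (x :: l) * T l.toFinset y = f (y :: l) * T l.toFinset x := by
  obtain ⟨δ, hδ, hδ0⟩ := hS.exists_alternating hSk
  have hδY : ∀ Y ⊆ S, Y.card = k - 2 → ∀ x ∈ S, x ∉ Y → δ (x :: Y.toList) ≠ 0 := by
    intro Y hY hYc x hx hxY
    refine hδ0 _ ?_ ?_ ?_
    · exact List.nodup_cons.2 ⟨by simpa using hxY, Y.nodup_toList⟩
    · intro v hv
      simp only [List.mem_cons, Finset.mem_toList] at hv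
      rcases hv with rfl | hv
      exacts [hx, hY hv]
    · simp only [List.length_cons, Finset.length_toList]; omega
  have hpow : ∀ N : ℕ, ((-1 : K) ^ N) ≠ 0 := fun N => pow_ne_zero _ (neg_ne_zero.2 one_ne_zero)
  obtain ⟨g, hg0, hg⟩ := exists_potential (k - 2)
    (fun Y x => T Y x / δ (x :: Y.toList) ^ (t + 1)) S
    (fun Y hY hYc x hx hxY => div_ne_zero (hT.apply_ne_zero hY hYc hx hxY)
      (pow_ne_zero _ (hδY Y hY hYc x hx hxY))) (by
    intro D hD hDc x hx y hy z hz hxD hyD hzD hxy hyz hxz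
    have hseg := segre_tangents hS hcard hT (l := D.toList) (x := x) (y := y) (z := z)
      (by rw [Finset.length_toList]; omega)
      (by simp [hxD, hyD, hzD, hxy, hyz, hxz, D.nodup_toList])
      (by
        intro v hv
        simp only [List.mem_cons, Finset.mem_toList] at hv
        rcases hv with rfl | rfl | rfl | hv
        exacts [hx, hy, hz, hD hv])
    rw [Finset.toList_toFinset] at hseg
    have hperm : ∀ a, a ∉ D → ∃ N : ℕ, ∀ b,
        δ (b :: (insert a D).toList) = (-1) ^ N * δ (b :: a :: D.toList) := fun a ha => by
      obtain ⟨N, hN⟩ := exists_pow_of_perm (Finset.toList_insert ha)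
      exact ⟨N, fun b => hN K δ (-1) hδ [b]⟩
    obtain ⟨Nx, hNx⟩ := hperm x hxD
    obtain ⟨Ny, hNy⟩ := hperm y hyD
    obtain ⟨Nz, hNz⟩ := hperm z hzD
    have hne : ∀ a b, a ∈ S → b ∈ S → a ∉ D → b ∉ D → a ≠ b →
        δ (a :: b :: D.toList) ≠ 0 := by
      intro a b ha hb haD hbD hab
      refine hδ0 _ (by simp [haD, hbD, hab, D.nodup_toList]) ?_
        (by simp only [List.length_cons, Finset.length_toList]; omega)
      intro v hv
      simp only [List.mem_cons, Finset.mem_toList] at hv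
      rcases hv with rfl | rfl | hv
      exacts [ha, hb, hD hv]
    have nxy := hne x y hx hy hxD hyD hxy
    have nyz := hne y z hy hz hyD hzD hyz
    have nzx := hne z x hz hx hzD hxD (Ne.symm hxz)
    have syx : δ (y :: x :: D.toList) = -1 * δ (x :: y :: D.toList) := hδ [] _ _ _
    have szy : δ (z :: y :: D.toList) = -1 * δ (y :: z :: D.toList) := hδ [] _ _ _
    have sxz : δ (x :: z :: D.toList) = -1 * δ (z :: x :: D.toList) := hδ [] _ _ _
    simp only [hNx, hNy, hNz]
    rw [syx, szy, sxz]
    have hNx0 := pow_ne_zero (t + 1) (hpow Nx)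
    have hNy0 := pow_ne_zero (t + 1) (hpow Ny)
    have hNz0 := pow_ne_zero (t + 1) (hpow Nz)
    have he := hpow (t + 1)
    have hee : ((-1 : K) ^ (t + 1)) * (-1) ^ (t + 1) = 1 := by
      rw [← pow_add, ← two_mul, pow_mul]; simp
    replace nxy := pow_ne_zero (t + 1) nxy
    replace nyz := pow_ne_zero (t + 1) nyz
    replace nzx := pow_ne_zero (t + 1) nzx
    simp only [mul_pow]
    generalize (-1 : K) ^ (t + 1) = e at *
    generalize ((-1 : K) ^ Nx) ^ (t + 1) = a at *
    generalize ((-1 : K) ^ Ny) ^ (t + 1) = b at *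
    generalize ((-1 : K) ^ Nz) ^ (t + 1) = c at *
    rw [div_mul_div_comm, div_mul_div_comm, div_mul_div_comm, div_mul_div_comm, hseg,
      div_eq_div_iff
        (mul_ne_zero (mul_ne_zero (mul_ne_zero hNx0 (mul_ne_zero he nxy))
          (mul_ne_zero hNy0 (mul_ne_zero he nyz))) (mul_ne_zero hNz0 (mul_ne_zero he nzx)))
        (mul_ne_zero (mul_ne_zero (mul_ne_zero hNy0 nxy) (mul_ne_zero hNz0 nyz))
          (mul_ne_zero hNx0 nzx))]
    generalize T (insert y D) x * T (insert z D) y * T (insert x D) z = W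
    linear_combination (-(W * e * a * b * c * δ (x :: y :: D.toList) ^ (t + 1) *
      δ (y :: z :: D.toList) ^ (t + 1) * δ (z :: x :: D.toList) ^ (t + 1))) * hee)
  refine ⟨fun l => g l.toFinset * δ l ^ (t + 1), ?_, ?_, ?_⟩
  · intro u a b v
    have hset : (u ++ a :: b :: v).toFinset = (u ++ b :: a :: v).toFinset := by
      ext x; simp; tauto
    simp only [hset, hδ u a b v, mul_pow]
    ring
  · intro l hnd hlS hl
    refine mul_ne_zero (hg0 _ (fun v hv => hlS v (List.mem_toFinset.1 hv)) ?_)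
      (pow_ne_zero _ (hδ0 l hnd hlS hl))
    rw [List.toFinset_card_of_nodup hnd]
    omega
  · intro l x y hl hxl hyl hlS
    rw [List.nodup_cons] at hxl hyl
    have hY : l.toFinset ⊆ S := fun v hv => hlS v (by simp [List.mem_toFinset.1 hv])
    have hYc : l.toFinset.card = k - 2 := by
      rw [List.toFinset_card_of_nodup hxl.2]; omega
    have hxS : x ∈ S := hlS x (by simp)
    have hyS : y ∈ S := hlS y (by simp)
    have hx' : x ∉ l.toFinset := by simpa using hxl.1
    have hy' : y ∉ l.toFinset := by simpa using hyl.1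
    have h := hg l.toFinset hY hYc x hxS hx' y hyS hy'
    obtain ⟨N, hN⟩ := exists_pow_of_perm (List.toFinset_toList hxl.2)
    have hNx := hN K δ (-1) hδ [x]
    have hNy := hN K δ (-1) hδ [y]
    simp only [List.singleton_append] at hNx hNy
    have hx0 := hδY l.toFinset hY hYc x hxS hx'
    have hy0 := hδY l.toFinset hY hYc y hyS hy'
    rw [hNx] at hx0 h
    rw [hNy] at hy0 h
    have hx1 := right_ne_zero_of_mul hx0
    have hy1 := right_ne_zero_of_mul hy0
    have hN0 := hpow N
    simp only [mul_pow, List.toFinset_cons] at h ⊢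
    field_simp at h
    linear_combination h

theorem segreP_eq_div {K : Type} [Field K] [DecidableEq K] {k t : ℕ} {S : Finset (Fin k → K)}
    {T : Finset (Fin k → K) → (Fin k → K) → K} (hT : IsTangentFamily t S T)
    {f : List (Fin k → K) → K} {c : K} (hc : c ≠ 0)
    (hf : ∀ u a b v, f (u ++ a :: b :: v) = c * f (u ++ b :: a :: v))
    (hf0 : ∀ l : List (Fin k → K), l.Nodup → (∀ v ∈ l, v ∈ S) → l.length + 1 = k → f l ≠ 0)
    (hfT : ∀ (l : List (Fin k → K)) (x y : Fin k → K), l.length + 2 = k →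
      (x :: l).Nodup → (y :: l).Nodup → (∀ v ∈ x :: y :: l, v ∈ S) →
      f (x :: l) * T l.toFinset y = f (y :: l) * T l.toFinset x)
    (A B D : List (Fin k → K)) (hAB : A.length = B.length) (hk : A.length + D.length + 1 = k)
    (hnd : (A ++ B ++ D).Nodup) (hS : ∀ v ∈ A ++ B ++ D, v ∈ S) :
    segreP T D.toFinset A B = f (A ++ D) / f (B ++ D) := by
  have hsub : ∀ j, (A.take j ++ B.drop j ++ D).Sublist (A ++ B ++ D) := fun j =>
    ((List.take_sublist _ _).append (List.drop_sublist _ _)).append (List.Sublist.refl _)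
  have hG0 : ∀ j ≤ A.length, f (A.take j ++ B.drop j ++ D) ≠ 0 := fun j hj =>
    hf0 _ (hnd.sublist (hsub j)) (fun v hv => hS v ((hsub j).subset hv))
      (by simp only [List.length_append, List.length_take, List.length_drop]; omega)
  have key : ∀ m ≤ A.length, ∏ j ∈ Finset.range m,
      (T (D.toFinset ∪ (A.take j).toFinset ∪ (B.drop (j + 1)).toFinset) (A.getD j 0) *
        (T (D.toFinset ∪ (A.take j).toFinset ∪ (B.drop (j + 1)).toFinset) (B.getD j 0))⁻¹) =
      f (A.take m ++ B.drop m ++ D) / f (B ++ D) := by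
    intro m
    induction m with
    | zero =>
      intro _
      have := hG0 0 (Nat.zero_le _)
      simp only [List.take_zero, List.drop_zero, List.nil_append] at this
      simp [div_self this]
    | succ j ih =>
      intro hj
      have hjA : j < A.length := hj
      have hjB : j < B.length := hAB ▸ hj
      rw [Finset.prod_range_succ, ih (by omega)]
      have hset : D.toFinset ∪ (A.take j).toFinset ∪ (B.drop (j + 1)).toFinset =
          (A.take j ++ (B.drop (j + 1) ++ D)).toFinset := by
        ext v
        simp only [Finset.mem_union, List.mem_toFinset, List.mem_append]
        tauto
      rw [hset, List.getD_eq_getElem _ _ hjA, List.getD_eq_getElem _ _ hjB]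
      have eA : A.take (j + 1) ++ B.drop (j + 1) ++ D =
          A.take j ++ A[j] :: (B.drop (j + 1) ++ D) := by
        rw [List.take_succ_eq_append_getElem hjA]
        simp only [List.append_assoc, List.cons_append, List.nil_append]
      have eB : A.take j ++ B.drop j ++ D = A.take j ++ B[j] :: (B.drop (j + 1) ++ D) := by
        rw [List.drop_eq_getElem_cons hjB]
        simp only [List.append_assoc, List.cons_append]
      have hsA := hsub (j + 1)
      have hsB := hsub j
      have h0 := hG0 j (by omega)
      rw [eA] at hsA ⊢
      rw [eB] at hsB h0 ⊢
      have hgA := apply_middle_cons hf A[j] (A.take j) [] (B.drop (j + 1) ++ D)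
      have hgB := apply_middle_cons hf B[j] (A.take j) [] (B.drop (j + 1) ++ D)
      simp only [List.nil_append, List.cons_append] at hgA hgB
      rw [hgB] at h0
      rw [hgA, hgB]
      have hndA := List.nodup_middle.1 (hnd.sublist hsA)
      have hndB := List.nodup_middle.1 (hnd.sublist hsB)
      have hlen : (A.take j ++ (B.drop (j + 1) ++ D)).length + 2 = k := by
        simp only [List.length_append, List.length_take, List.length_drop]; omega
      have hmA : ∀ v ∈ A[j] :: (A.take j ++ (B.drop (j + 1) ++ D)), v ∈ S := fun v hv =>
        hS v (hsA.subset (List.perm_middle.mem_iff.2 hv))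
      have hmB : ∀ v ∈ B[j] :: (A.take j ++ (B.drop (j + 1) ++ D)), v ∈ S := fun v hv =>
        hS v (hsB.subset (List.perm_middle.mem_iff.2 hv))
      have h := hfT _ A[j] B[j] hlen hndA hndB (fun v hv => by
        rcases List.mem_cons.1 hv with rfl | hv
        exacts [hmA _ List.mem_cons_self, hmB v hv])
      have hTB : T (A.take j ++ (B.drop (j + 1) ++ D)).toFinset B[j] ≠ 0 := by
        refine hT.apply_ne_zero
          (fun v hv => hmA v (List.mem_cons_of_mem _ (List.mem_toFinset.1 hv))) ?_
          (hmB _ List.mem_cons_self) (by simpa using (List.nodup_cons.1 hndB).1)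
        rw [List.toFinset_card_of_nodup (List.nodup_cons.1 hndB).2]
        omega
      have h1 : f (B ++ D) ≠ 0 := by simpa using hG0 0 (Nat.zero_le _)
      field_simp
      linear_combination -h
  have := key A.length le_rfl
  rw [List.take_length, List.drop_eq_nil_of_le hAB.ge, List.append_nil] at this
  exact this

theorem mul_prod_detCols_inv_eq_of_perm {K : Type} [Field K] {k t : ℕ}
    {f : List (Fin k → K) → K}
    (hf : ∀ u a b v, f (u ++ a :: b :: v) = (-1) ^ (t + 1) * f (u ++ b :: a :: v))
    {l l' : List (Fin k → K)} (h : l.Perm l') (hl : l.length + 1 = k)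
    (Z : Finset (Fin k → K)) (hZ : Z.card = t + 1) :
    f l * ∏ z ∈ Z, (detCols (z :: l))⁻¹ = f l' * ∏ z ∈ Z, (detCols (z :: l'))⁻¹ := by
  obtain ⟨N, hN, hNf⟩ := exists_pow_of_perm_detCols h hl
  simp only [hNf f _ hf, hN, mul_inv, Finset.prod_mul_distrib, Finset.prod_const, hZ]
  have : (((-1 : K) ^ (t + 1)) ^ N) * (((-1) ^ N)⁻¹) ^ (t + 1) = 1 := by
    rw [inv_pow, ← pow_mul, ← pow_mul, mul_comm N, mul_inv_cancel₀]
    exact pow_ne_zero _ (neg_ne_zero.2 one_ne_zero)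
  linear_combination (f l' * ∏ z ∈ Z, (detCols (z :: l'))⁻¹) * this

theorem sum_potential_mul_prod_inv_eq_zero {K : Type} [Field K] [DecidableEq K] {k t : ℕ}
    {S : Finset (Fin k → K)} (hS : IsArc S) {T : Finset (Fin k → K) → (Fin k → K) → K}
    (hT : IsTangentFamily t S T) {f : List (Fin k → K) → K}
    (hfT : ∀ (l : List (Fin k → K)) (x y : Fin k → K), l.length + 2 = k →
      (x :: l).Nodup → (y :: l).Nodup → (∀ v ∈ x :: y :: l, v ∈ S) →
      f (x :: l) * T l.toFinset y = f (y :: l) * T l.toFinset x)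
    {l : List (Fin k → K)} (hl : l.length + 2 = k) (hnd : l.Nodup) (hlS : ∀ v ∈ l, v ∈ S)
    (E : Finset (Fin k → K)) (hES : E ⊆ S) (hEl : ∀ x ∈ E, x ∉ l) (hE : E.card = t + 2) :
    ∑ x ∈ E, f (x :: l) * ∏ z ∈ E.erase x, (detCols (z :: x :: l))⁻¹ = 0 := by
  obtain ⟨y, hy⟩ := Finset.card_pos.1 (by omega : 0 < E.card)
  have hTy : T l.toFinset y ≠ 0 := hT.apply_ne_zero
    (fun v hv => hlS v (List.mem_toFinset.1 hv))
    (by rw [List.toFinset_card_of_nodup hnd]; omega) (hES hy) (by simpa using hEl y hy)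
  have h := sum_tangent_mul_prod_inv_eq_zero hS hT hl hnd hlS E hES hEl hE
  calc _ = f (y :: l) / T l.toFinset y *
        ∑ x ∈ E, T l.toFinset x * ∏ z ∈ E.erase x, (detCols (z :: x :: l))⁻¹ := by
        rw [Finset.mul_sum]
        refine Finset.sum_congr rfl fun x hx => ?_
        have := hfT l x y hl (List.nodup_cons.2 ⟨hEl x hx, hnd⟩)
          (List.nodup_cons.2 ⟨hEl y hy, hnd⟩) (fun v hv => by
            simp only [List.mem_cons] at hv
            rcases hv with rfl | rfl | hv
            exacts [hES hx, hES hy, hlS v hv])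
        rw [← mul_assoc, div_mul_eq_mul_div, ← this, mul_div_cancel_right₀ _ hTy]
    _ = 0 := by rw [h, mul_zero]

theorem subseqC_eq_subseq_sdiff {α : Type} (d : α) (L : List α) (s : Finset ℕ) :
    subseqC d L s = subseq d L (Finset.range L.length \ s) := by
  unfold subseq subseqC
  congr 1
  refine List.filter_congr fun i hi => ?_
  simp [List.mem_range.1 hi]

theorem sum_powersetCard_toFinset_subseqC {α K : Type} [DecidableEq α] [AddCommMonoid K]
    (d : α) (L : List α) (hL : L.Nodup) (n : ℕ) (hn : n ≤ L.length) (H : Finset α → K) :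
    ∑ s ∈ Finset.powersetCard n (Finset.range L.length), H (subseqC d L s).toFinset =
      ∑ C ∈ Finset.powersetCard (L.length - n) L.toFinset, H C := by
  rw [← sum_powersetCard_toFinset d L hL]
  simp only [subseqC_eq_subseq_sdiff]
  refine Finset.sum_bij' (fun s _ => Finset.range L.length \ s)
    (fun s _ => Finset.range L.length \ s) ?_ ?_ ?_ ?_ (fun _ _ => rfl)
  · intro s hs
    rw [Finset.mem_powersetCard] at hs ⊢
    refine ⟨Finset.sdiff_subset, ?_⟩
    rw [Finset.card_sdiff_of_subset hs.1, Finset.card_range, hs.2]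
  · intro s hs
    rw [Finset.mem_powersetCard] at hs ⊢
    refine ⟨Finset.sdiff_subset, ?_⟩
    rw [Finset.card_sdiff_of_subset hs.1, Finset.card_range, hs.2]
    omega
  · intro s hs
    exact Finset.sdiff_sdiff_eq_self (Finset.mem_powersetCard.1 hs).1
  · intro s hs
    exact Finset.sdiff_sdiff_eq_self (Finset.mem_powersetCard.1 hs).1

theorem toFinset_union_subseq_eq_sdiff {α : Type} [DecidableEq α] (d : α) (M L : List α)
    (hL : L.Nodup) (hML : ∀ v ∈ M, v ∉ L) (s : Finset ℕ) :
    M.toFinset ∪ (subseq d L s).toFinset =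
      (M.toFinset ∪ L.toFinset) \ (subseqC d L s).toFinset := by
  have hp := subseqC_append_subseq_perm d L s
  have hdisj := (List.nodup_append.1 (hp.nodup_iff.2 hL)).2.2
  ext v
  have hv : v ∈ L ↔ v ∈ subseqC d L s ∨ v ∈ subseq d L s := by
    rw [← hp.mem_iff, List.mem_append]
  have := hML v
  have h2 : v ∈ subseqC d L s → v ∉ subseq d L s := fun h h' => hdisj v h v h' rfl
  simp only [Finset.mem_union, Finset.mem_sdiff, List.mem_toFinset]
  tauto

theorem toFinset_subseqC_union_eq_sdiff {α : Type} [DecidableEq α] (d : α) (M L : List α)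
    (hL : L.Nodup) (hML : ∀ v ∈ M, v ∉ L) (s : Finset ℕ) :
    (subseqC d L s).toFinset ∪ M.toFinset =
      (L.toFinset ∪ M.toFinset) \ (subseq d L s).toFinset := by
  have hp := subseqC_append_subseq_perm d L s
  have hdisj := (List.nodup_append.1 (hp.nodup_iff.2 hL)).2.2
  ext v
  have hv : v ∈ L ↔ v ∈ subseqC d L s ∨ v ∈ subseq d L s := by
    rw [← hp.mem_iff, List.mem_append]
  have := hML v
  have h2 : v ∈ subseqC d L s → v ∉ subseq d L s := fun h h' => hdisj v h v h' rfl
  simp only [Finset.mem_union, Finset.mem_sdiff, List.mem_toFinset]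
  tauto

/-- the main lemma: for pairwise disjoint ordered subsequences `A` (size
`n`), `L` (size `r`), `D` (size `k − 1 − r`) and `Ω` (size `t + 1 − n`) of `S`, if
`n ≤ r ≤ n + p − 1` and `r ≤ t + 2` then
`∑_{B ⊆ L, |B| = n} (−1)^{σ(B,L)} P_{D∪(L∖B)}(A, B) ∏_{z ∈ Ω∪B} det(z, A, L∖B, D)⁻¹ =
 (−1)^{(r−n)(nt+n+1)} ∑_{Δ ⊆ Ω, |Δ| = r−n} P_D(A ⌢ Δ, L) ∏_{z ∈ (Ω∖Δ)∪L} det(z, A, Δ, D)⁻¹`. -/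
theorem statement9 (p h k q t n r : ℕ) (hp : p.Prime) (hh : 1 ≤ h) (hq : q = p ^ h)
    (hk : 3 ≤ k)
    (F : Type) [Field F] [Fintype F] [DecidableEq F] (hF : Fintype.card F = q)
    (S : Finset (Fin k → F))
    (harc : ∀ A ⊆ S, A.card = k →
      LinearIndependent F (fun v : {x // x ∈ A} => (v : Fin k → F)) ∧
      Submodule.span F (A : Set (Fin k → F)) = ⊤)
    (ht : S.card + t = q + k - 1) (ht1 : 1 ≤ t) (hSk : k ≤ S.card)
    (T : Finset (Fin k → F) → (Fin k → F) → F) (hT : IsTangentFamily t S T)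
    (A L D Om : List (Fin k → F))
    (hA : A.length = n) (hL : L.length = r) (hD : D.length + r + 1 = k)
    (hOm : Om.length + n = t + 1)
    (hnd : (A ++ L ++ D ++ Om).Nodup) (hin : ∀ v ∈ A ++ L ++ D ++ Om, v ∈ S)
    (hnr : n ≤ r) (hrp : r + 1 ≤ n + p) (hrt : r ≤ t + 2) :
    ∑ s ∈ Finset.powersetCard n (Finset.range L.length),
      (-1 : F) ^ ((t + 1) * invCount s L.length) *
        segreP T (D.toFinset ∪ (subseqC 0 L s).toFinset) A (subseq 0 L s) *
        ∏ z ∈ Om.toFinset ∪ (subseq 0 L s).toFinset,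
          (detCols (z :: (A ++ subseqC 0 L s ++ D)))⁻¹ =
    (-1 : F) ^ ((r - n) * (n * t + n + 1)) *
      ∑ sd ∈ Finset.powersetCard (r - n) (Finset.range Om.length),
        segreP T D.toFinset (A ++ subseq 0 Om sd) L *
          ∏ z ∈ (subseqC 0 Om sd).toFinset ∪ L.toFinset,
            (detCols (z :: (A ++ subseq 0 Om sd ++ D)))⁻¹ := by
  have hS : IsArc S := harc
  obtain ⟨f, hf, hf0, hfT⟩ := exists_tangent_potential hk hS hSk (by rw [hF, ht]) hT
  have hεsq : ∀ N : ℕ, (((-1 : F) ^ (t + 1)) ^ N) * (((-1 : F) ^ (t + 1)) ^ N) = 1 := fun N => by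
    rw [← pow_mul, ← pow_add, ← two_mul, pow_mul, neg_one_sq, one_pow]
  have hε : ((-1 : F) ^ (t + 1)) ≠ 0 := pow_ne_zero _ (neg_ne_zero.2 one_ne_zero)
  have hLnd : L.Nodup := hnd.sublist (by
    rw [List.append_assoc]
    exact (List.sublist_append_right A L).trans (List.sublist_append_left _ _))
  have hOmnd : Om.Nodup := hnd.sublist (List.sublist_append_right _ _)
  have hOmL : ∀ v ∈ Om, v ∉ L := fun v hv hvL =>
    (List.nodup_append.1 hnd).2.2 v (by simp [hvL]) v hv rfl
  set E := Om.toFinset ∪ L.toFinset with hE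
  have hdisj : Disjoint Om.toFinset L.toFinset := by
    rw [Finset.disjoint_left]
    exact fun v hv hvL => hOmL v (List.mem_toFinset.1 hv) (List.mem_toFinset.1 hvL)
  have hEcard : E.card = t + 1 + (r - n) := by
    rw [hE, Finset.card_union_of_disjoint hdisj, List.toFinset_card_of_nodup hOmnd,
      List.toFinset_card_of_nodup hLnd]
    omega
  have hEm : ∀ v, v ∈ E ↔ v ∈ Om ∨ v ∈ L := fun v => by simp [hE]
  have hES : E ⊆ S := fun v hv => hin v (by
    rcases (hEm v).1 hv with h | h <;> simp [h])
  have hAD : (A ++ D).Nodup := hnd.sublist (by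
    rw [List.append_assoc, List.append_assoc]
    exact (List.Sublist.refl A).append
      ((List.sublist_append_left D Om).trans (List.sublist_append_right L _)))
  have hADS : ∀ v ∈ A ++ D, v ∈ S := fun v hv => hin v (by
    rcases List.mem_append.1 hv with h | h <;> simp [h])
  have hADE : ∀ v ∈ E, v ∉ A ++ D := by
    have hnd' : ((A ++ D) ++ (Om ++ L)).Nodup := by
      refine (List.Perm.nodup_iff ?_).1 hnd
      rw [List.perm_iff_count]
      intro v
      simp only [List.count_append]
      omega
    intro v hv hv'
    exact (List.nodup_append.1 hnd').2.2 v hv' v (List.mem_append.2 ((hEm v).1 hv)) rfl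
  let H : Finset (Fin k → F) → F := fun C =>
    f (A ++ C.toList ++ D) * ∏ z ∈ E \ C, (detCols (z :: (A ++ C.toList ++ D)))⁻¹
  have hH : ∀ C : List (Fin k → F), C.Nodup → C.length = r - n → (∀ v ∈ C, v ∈ E) →
      H C.toFinset = f (A ++ C ++ D) *
        ∏ z ∈ E \ C.toFinset, (detCols (z :: (A ++ C ++ D)))⁻¹ := by
    intro C hC hCl hCE
    have hCp : C.toFinset.toList.Perm C := List.toFinset_toList hC
    refine mul_prod_detCols_inv_eq_of_perm hf ((hCp.append_left A).append_right D) ?_ _ ?_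
    · simp only [List.length_append, hCp.length_eq]
      omega
    · rw [Finset.card_sdiff_of_subset fun v hv => hCE v (List.mem_toFinset.1 hv),
        List.toFinset_card_of_nodup hC]
      omega
  have hleft : ∀ s ∈ Finset.powersetCard n (Finset.range L.length),
      (-1 : F) ^ ((t + 1) * invCount s L.length) *
        segreP T (D.toFinset ∪ (subseqC 0 L s).toFinset) A (subseq 0 L s) *
        ∏ z ∈ Om.toFinset ∪ (subseq 0 L s).toFinset,
          (detCols (z :: (A ++ subseqC 0 L s ++ D)))⁻¹ =
      ((-1) ^ (t + 1)) ^ (n * (r - n)) / f (L ++ D) * H (subseqC 0 L s).toFinset := by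
    intro s hs
    rw [Finset.mem_powersetCard] at hs
    have hp := subseqC_append_subseq_perm 0 L s
    have hBl : (subseq 0 L s).length = n := by
      rw [length_subseq, Finset.filter_mem_eq_inter, Finset.inter_eq_right.2 hs.1, hs.2]
    have hfL := apply_subseqC_append_subseq hf 0 s L D
    rw [toFinset_union_subseq_eq_sdiff 0 Om L hLnd hOmL, ← hE]
    generalize subseq 0 L s = B at *
    generalize subseqC 0 L s = C at *
    have hCl : C.length = r - n := by
      have := hp.length_eq
      rw [List.length_append] at this
      omega
    have hCB := hp.nodup_iff.2 hLnd
    rw [hH C (hCB.sublist (List.sublist_append_left _ _)) hCl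
      fun v hv => (hEm v).2 (Or.inr (hp.mem_iff.1 (List.mem_append_left _ hv)))]
    have hq : (A ++ B ++ (C ++ D) ++ Om).Perm (A ++ L ++ D ++ Om) := by
      rw [List.perm_iff_count] at hp ⊢
      intro v
      have := hp v
      simp only [List.count_append] at this ⊢
      omega
    have hset : D.toFinset ∪ C.toFinset = (C ++ D).toFinset := by
      rw [List.toFinset_append, Finset.union_comm]
    have hfA := segreP_eq_div hT hε hf hf0 hfT A B (C ++ D) (by omega)
      (by rw [List.length_append]; omega)
      ((hq.nodup_iff.2 hnd).sublist (List.sublist_append_left _ _))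
      (fun v hv => hin v (hq.mem_iff.1 (List.mem_append_left _ hv)))
    have hcomm := apply_append_comm hf C B D []
    simp only [List.nil_append, hCl, hBl] at hcomm
    rw [hset, hfA, hfL, hcomm, pow_mul, List.append_assoc B, List.append_assoc A C D]
    have h1 := hεsq (invCount s L.length)
    have h0 := pow_ne_zero (n * (r - n)) hε
    have h2 := pow_ne_zero (invCount s L.length) hε
    rw [mul_comm (r - n) n]
    generalize ((-1 : F) ^ (t + 1)) ^ invCount s L.length = x at *
    generalize ((-1 : F) ^ (t + 1)) ^ (n * (r - n)) = y at *
    rw [eq_inv_of_mul_eq_one_left h1]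
    field_simp
    rw [pow_two, h1, one_mul]
  have hright : ∀ s ∈ Finset.powersetCard (r - n) (Finset.range Om.length),
      segreP T D.toFinset (A ++ subseq 0 Om s) L *
          ∏ z ∈ (subseqC 0 Om s).toFinset ∪ L.toFinset,
            (detCols (z :: (A ++ subseq 0 Om s ++ D)))⁻¹ =
        (f (L ++ D))⁻¹ * H (subseq 0 Om s).toFinset := by
    intro s hs
    rw [Finset.mem_powersetCard] at hs
    have hp := subseqC_append_subseq_perm 0 Om s
    have hCl : (subseq 0 Om s).length = r - n := by
      rw [length_subseq, Finset.filter_mem_eq_inter, Finset.inter_eq_right.2 hs.1, hs.2]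
    rw [toFinset_subseqC_union_eq_sdiff 0 L Om hOmnd fun v hv hv' => hOmL v hv' hv]
    generalize subseq 0 Om s = C at *
    generalize subseqC 0 Om s = B at *
    rw [hH C ((hp.nodup_iff.2 hOmnd).sublist (List.sublist_append_right _ _)) hCl
      fun v hv => (hEm v).2 (Or.inl (hp.mem_iff.1 (List.mem_append_right _ hv)))]
    have hq : (A ++ C ++ L ++ D ++ B).Perm (A ++ L ++ D ++ Om) := by
      rw [List.perm_iff_count] at hp ⊢
      intro v
      have := hp v
      simp only [List.count_append] at this ⊢
      omega
    rw [segreP_eq_div hT hε hf hf0 hfT (A ++ C) L D (by rw [List.length_append]; omega)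
      (by rw [List.length_append]; omega)
      ((hq.nodup_iff.2 hnd).sublist (List.sublist_append_left _ _))
      (fun v hv => hin v (hq.mem_iff.1 (List.mem_append_left _ hv)))]
    ring
  have hchar : ∀ j < r - n, ((j + 1 : ℕ) : F) ≠ 0 := by
    have := Fact.mk hp
    have : CharP F p := charP_of_card_eq_prime_pow (f := h) (by rw [hF, hq])
    intro j hj h0
    rw [CharP.cast_eq_zero_iff F p] at h0
    exact Nat.not_dvd_of_pos_of_lt (Nat.succ_pos j) (by omega) h0
  have hsum : ∀ Y ⊆ E, Y.card + 1 = r - n → ∑ x ∈ E \ Y, H (insert x Y) = 0 := by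
    intro Y hY hYc
    have hq : (A ++ Y.toList ++ D).Perm (Y.toList ++ (A ++ D)) := by
      rw [← List.append_assoc]
      exact List.perm_append_comm.append_right D
    have hmem : ∀ v, v ∈ A ++ Y.toList ++ D ↔ v ∈ Y ∨ v ∈ A ++ D := fun v => by
      rw [hq.mem_iff, List.mem_append, Finset.mem_toList]
    have hlen : (A ++ Y.toList ++ D).length + 2 = k := by
      simp only [List.length_append, Finset.length_toList]
      omega
    rw [← sum_potential_mul_prod_inv_eq_zero hS hT hfT (l := A ++ Y.toList ++ D) hlen ?_ ?_
      (E \ Y) (Finset.sdiff_subset.trans hES) ?_ ?_]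
    · refine Finset.sum_congr rfl fun x hx => ?_
      rw [Finset.mem_sdiff] at hx
      have hins : E \ insert x Y = (E \ Y).erase x := by
        rw [Finset.sdiff_insert]
      simp only [H, hins]
      refine mul_prod_detCols_inv_eq_of_perm hf ?_ ?_ _ ?_
      · refine (((Finset.toList_insert hx.2).append_left A).append_right D).trans ?_
        rw [List.append_assoc, List.append_assoc]
        exact List.perm_middle
      · simp only [List.length_append, Finset.length_toList, Finset.card_insert_of_notMem hx.2]
        omega
      · rw [Finset.card_erase_of_mem (Finset.mem_sdiff.2 hx), Finset.card_sdiff_of_subset hY]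
        omega
    · rw [hq.nodup_iff, List.nodup_append]
      refine ⟨Y.nodup_toList, hAD, fun v hv w hw hvw => ?_⟩
      exact hADE v (hY (Finset.mem_toList.1 hv)) (hvw ▸ hw)
    · exact fun v hv => ((hmem v).1 hv).elim (fun h => hES (hY h)) (hADS v)
    · intro v hv hv'
      rw [Finset.mem_sdiff] at hv
      exact ((hmem v).1 hv').elim hv.2 (hADE v hv.1)
    · rw [Finset.card_sdiff_of_subset hY]
      omega
  have hEL : E \ L.toFinset = Om.toFinset := by
    rw [hE, Finset.union_sdiff_cancel_right hdisj]
  rw [Finset.sum_congr rfl hleft, Finset.sum_congr rfl hright, ← Finset.mul_sum, ← Finset.mul_sum,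
    sum_powersetCard_toFinset_subseqC 0 L hLnd n (by omega) H,
    sum_powersetCard_toFinset 0 Om hOmnd, hL,
    sum_powersetCard_eq_neg_one_pow_mul E L.toFinset Finset.subset_union_right (r - n) hchar H hsum,
    hEL]
  have hsign : (-1 : F) ^ ((r - n) * (n * t + n + 1)) =
      ((-1) ^ (t + 1)) ^ (n * (r - n)) * (-1) ^ (r - n) := by
    rw [← pow_mul, ← pow_add]
    congr 1
    ring
  rw [hsign]
  ring
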